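/- arXiv:1801.01072 — 13 statements merged into one kernel-verified Lean document; each statement's English description precedes it below -/
import Mathlib

section
/- Let R be an n×n real symmetric positive definite matrix with unit trace whose eigenvalues all lie in the interval [ℓ, u] for some 0 < ℓ ≤ u ≤ 1, and let C = I_n − u⁻¹R. Then the von Neumann entropy of R satisfies H(R) = ln(1/u) + Σ_{k=1}^∞ tr(R C^k)/k, where the series on the right-hand side converges. -/
open Matrix

lemma trace_conj_aux {n : ℕ} (R : Matrix (Fin n) (Fin n) ℝ) (h : R.IsHermitian)
    (u : ℝ) (k : ℕ) :
    (R * (1 - u⁻¹ • R) ^ k).trace =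
      ∑ i, h.eigenvalues i * (1 - u⁻¹ * h.eigenvalues i) ^ k := by
  have hs := h.spectral_theorem
  set φ := Unitary.conjStarAlgAut ℝ (Matrix (Fin n) (Fin n) ℝ) h.eigenvectorUnitary with hφ
  set D : Matrix (Fin n) (Fin n) ℝ := diagonal (RCLike.ofReal ∘ h.eigenvalues) with hD
  have h1 : R * (1 - u⁻¹ • R) ^ k = φ (D * (1 - u⁻¹ • D) ^ k) := by
    rw [map_mul, map_pow, map_sub, map_one, map_smul, ← hs]
  have h2 : D * (1 - u⁻¹ • D) ^ k =
      diagonal (fun i => h.eigenvalues i * (1 - u⁻¹ * h.eigenvalues i) ^ k) := by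
    have : (1 - u⁻¹ • D) = diagonal (fun i => 1 - u⁻¹ * h.eigenvalues i) := by
      rw [hD, ← diagonal_one, ← diagonal_smul, diagonal_sub]
      rfl
    rw [this, diagonal_pow, hD, diagonal_mul_diagonal]
    rfl
  rw [h1, h2, hφ, Unitary.conjStarAlgAut_apply, trace_mul_cycle, Unitary.coe_star_mul_self,
    one_mul, trace_diagonal]

/-- Taylor series expansion of the von Neumann entropy (Lemma 1 of the paper):
for a symmetric positive definite density matrix `R` with unit trace and eigenvalues
in `[ℓ, u]` with `0 < ℓ ≤ u ≤ 1`, setting `C = I − u⁻¹ R`, we have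
`H(R) = ln(1/u) + ∑_{k=1}^∞ tr(R C^k)/k`, and the series converges. -/
theorem vonNeumann_entropy_taylor_series {n : ℕ} (R : Matrix (Fin n) (Fin n) ℝ)
    (hR : R.PosDef) (htr : R.trace = 1) (ℓ u : ℝ)
    (hℓ : 0 < ℓ) (hℓu : ℓ ≤ u) (hu : u ≤ 1)
    (heig : ∀ i, hR.1.eigenvalues i ∈ Set.Icc ℓ u)
    (C : Matrix (Fin n) (Fin n) ℝ) (hC : C = 1 - u⁻¹ • R) :
    Summable (fun k : ℕ => (R * C ^ (k + 1)).trace / (k + 1)) ∧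
      (-∑ i, hR.1.eigenvalues i * Real.log (hR.1.eigenvalues i)) =
        Real.log (1 / u) + ∑' k : ℕ, (R * C ^ (k + 1)).trace / (k + 1) := by
  have hu0 : 0 < u := hℓ.trans_le hℓu
  have hsum1 : ∑ i, hR.1.eigenvalues i = 1 := by
    have := trace_conj_aux R hR.1 u 0
    simpa [htr] using this.symm
  have key : HasSum (fun k : ℕ => (R * C ^ (k + 1)).trace / (k + 1))
      (∑ i, hR.1.eigenvalues i * (Real.log u - Real.log (hR.1.eigenvalues i))) := by
    have : (fun k : ℕ => (R * C ^ (k + 1)).trace / ((k : ℝ) + 1)) = fun k : ℕ =>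
        ∑ i, hR.1.eigenvalues i *
          ((1 - u⁻¹ * hR.1.eigenvalues i) ^ (k + 1) / ((k : ℝ) + 1)) := by
      funext k
      rw [hC, trace_conj_aux R hR.1, Finset.sum_div]
      simp only [mul_div_assoc]
    rw [this]
    refine hasSum_sum fun i _ => HasSum.mul_left _ ?_
    obtain ⟨hl, hi⟩ := heig i
    have hpos : 0 < hR.1.eigenvalues i := hℓ.trans_le hl
    have h1 : 0 < u⁻¹ * hR.1.eigenvalues i := by positivity
    have h2 : u⁻¹ * hR.1.eigenvalues i ≤ 1 := by
      rw [inv_mul_le_iff₀ hu0]; linarith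
    have := Real.hasSum_pow_div_log_of_abs_lt_one (x := 1 - u⁻¹ * hR.1.eigenvalues i)
      (by rw [abs_lt]; constructor <;> linarith)
    have he : -Real.log (1 - (1 - u⁻¹ * hR.1.eigenvalues i)) =
        Real.log u - Real.log (hR.1.eigenvalues i) := by
      rw [sub_sub_cancel, Real.log_mul (by positivity) hpos.ne', Real.log_inv]
      ring
    rw [he] at this
    exact this
  refine ⟨key.summable, ?_⟩
  rw [key.tsum_eq]
  simp only [mul_sub, Finset.sum_sub_distrib, ← Finset.sum_mul, hsum1, one_div, Real.log_inv]
  ring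
end

section
/- Let R be an n×n real symmetric matrix whose eigenvalues all lie in [ℓ, u] with 0 < ℓ ≤ u, and let C = I_n − u⁻¹R. Then for every integer m ≥ 1, 0 ≤ Σ_{k=m+1}^∞ tr(R C^k)/k ≤ (1 − ℓ/u)^m · Σ_{k=1}^∞ tr(R C^k)/k. -/
open Matrix

theorem trace_aux {n : ℕ} (R : Matrix (Fin n) (Fin n) ℝ) (hR : R.IsHermitian) (u : ℝ) (k : ℕ) :
    (R * (1 - u⁻¹ • R) ^ k).trace
      = ∑ i, hR.eigenvalues i * (1 - hR.eigenvalues i / u) ^ k := by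
  have h := hR.spectral_theorem
  set φ := Unitary.conjStarAlgAut ℝ (Matrix (Fin n) (Fin n) ℝ) hR.eigenvectorUnitary with hφ
  set D : Matrix (Fin n) (Fin n) ℝ := diagonal hR.eigenvalues with hD
  have h' : R = φ D := h
  have h1 : R * (1 - u⁻¹ • R) ^ k = φ (D * (1 - u⁻¹ • D) ^ k) := by
    rw [map_mul, map_pow, map_sub, map_one, map_smul, ← h']
  have h2 : D * (1 - u⁻¹ • D) ^ k =
      diagonal (fun i => hR.eigenvalues i * (1 - hR.eigenvalues i / u) ^ k) := by
    have : (1 - u⁻¹ • D) = diagonal (fun i => 1 - hR.eigenvalues i / u) := by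
      rw [hD, ← diagonal_one, ← diagonal_smul, diagonal_sub]
      congr 1
      ext i
      simp [div_eq_inv_mul]
    rw [this, diagonal_pow, hD, diagonal_mul_diagonal]
    rfl
  rw [h1, h2, hφ, Unitary.conjStarAlgAut_apply, trace_mul_cycle]
  simp [trace_diagonal]

/-- Tail bound for the Taylor series of the entropy: for a symmetric matrix `R` with
eigenvalues in `[ℓ, u]`, `0 < ℓ ≤ u`, and `C = I − u⁻¹ R`, for every `m ≥ 1`,
`0 ≤ ∑_{k=m+1}^∞ tr(R C^k)/k ≤ (1 − ℓ/u)^m ∑_{k=1}^∞ tr(R C^k)/k`. -/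
theorem taylor_tail_bound {n : ℕ} (R : Matrix (Fin n) (Fin n) ℝ) (hR : R.IsHermitian)
    (ℓ u : ℝ) (hℓ : 0 < ℓ) (hℓu : ℓ ≤ u)
    (heig : ∀ i, hR.eigenvalues i ∈ Set.Icc ℓ u)
    (C : Matrix (Fin n) (Fin n) ℝ) (hC : C = 1 - u⁻¹ • R)
    (m : ℕ) (hm : 1 ≤ m) :
    0 ≤ ∑' k : ℕ, (R * C ^ (m + k + 1)).trace / (m + k + 1) ∧
      ∑' k : ℕ, (R * C ^ (m + k + 1)).trace / (m + k + 1) ≤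
        (1 - ℓ / u) ^ m * ∑' k : ℕ, (R * C ^ (k + 1)).trace / (k + 1) := by
  subst hC
  have hu : 0 < u := hℓ.trans_le hℓu
  simp only [trace_aux R hR u]
  set e := hR.eigenvalues
  have he0 : ∀ i, 0 ≤ e i := fun i => hℓ.le.trans (heig i).1
  have hc0 : ∀ i, 0 ≤ 1 - e i / u := fun i => by
    have := (div_le_one hu).2 (heig i).2
    linarith
  have hc1 : ∀ i, 1 - e i / u ≤ 1 - ℓ / u := fun i => by
    have := div_le_div_of_nonneg_right (heig i).1 hu.le
    linarith
  have hq0 : 0 ≤ 1 - ℓ / u := by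
    have := (div_le_one hu).2 hℓu
    linarith
  have hq1 : 1 - ℓ / u < 1 := by
    have := div_pos hℓ hu
    linarith
  have hnn : ∀ k : ℕ, 0 ≤ ∑ i, e i * (1 - e i / u) ^ k := fun k =>
    Finset.sum_nonneg fun i _ => mul_nonneg (he0 i) (pow_nonneg (hc0 i) _)
  have hstep : ∀ j k : ℕ, ∑ i, e i * (1 - e i / u) ^ (j + k)
      ≤ (1 - ℓ / u) ^ j * ∑ i, e i * (1 - e i / u) ^ k := fun j k => by
    rw [Finset.mul_sum]
    refine Finset.sum_le_sum fun i _ => ?_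
    have h1 := pow_le_pow_left₀ (hc0 i) (hc1 i) j
    have h2 := mul_nonneg (he0 i) (pow_nonneg (hc0 i) k)
    calc _ = (1 - e i / u) ^ j * (e i * (1 - e i / u) ^ k) := by ring
      _ ≤ _ := mul_le_mul_of_nonneg_right h1 h2
  have hterm : ∀ k : ℕ, (∑ i, e i * (1 - e i / u) ^ (m + k + 1)) / ((m : ℝ) + k + 1)
      ≤ (1 - ℓ / u) ^ m * ((∑ i, e i * (1 - e i / u) ^ (k + 1)) / ((k : ℝ) + 1)) := fun k => by
    rw [← mul_div_assoc]
    have hm0 : (0 : ℝ) ≤ m := Nat.cast_nonneg m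
    refine div_le_div₀ (mul_nonneg (pow_nonneg hq0 _) (hnn _)) ?_ (by positivity) (by linarith)
    exact hstep m (k + 1)
  have hsum : Summable fun k : ℕ => (∑ i, e i * (1 - e i / u) ^ (k + 1)) / ((k : ℝ) + 1) := by
    refine Summable.of_nonneg_of_le (fun k => div_nonneg (hnn _) (by positivity)) (fun k => ?_)
      ((summable_geometric_of_lt_one hq0 hq1).mul_right (∑ i, e i * (1 - e i / u) ^ 1))
    have hk : (0 : ℝ) ≤ k := Nat.cast_nonneg k
    exact (div_le_self (hnn _) (by linarith)).trans (hstep k 1)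
  have hsum' := hsum.mul_left ((1 - ℓ / u) ^ m)
  have hnn' : ∀ k : ℕ, 0 ≤ (∑ i, e i * (1 - e i / u) ^ (m + k + 1)) / ((m : ℝ) + k + 1) :=
    fun k => div_nonneg (hnn _) (by positivity)
  refine ⟨tsum_nonneg hnn', ?_⟩
  rw [← tsum_mul_left]
  exact (Summable.of_nonneg_of_le hnn' hterm hsum').tsum_le_tsum hterm hsum'
end

section
/- Let R be an n×n real symmetric positive definite matrix with unit trace whose eigenvalues lie in [ℓ, u] with 0 < ℓ ≤ u ≤ 1, let C = I_n − u⁻¹R, and let ε ∈ (0, 1). If the integer m satisfies m ≥ (u/ℓ)·ln(1/ε), then the truncated Taylor approximation satisfies | H(R) − ( ln(1/u) + Σ_{k=1}^m tr(R C^k)/k ) | ≤ ε · H(R). -/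
open Matrix

lemma scalar_taylor_bound (x : ℝ) (hx0 : 0 ≤ x) (hx1 : x < 1) (m : ℕ) :
    0 ≤ -Real.log (1 - x) - ∑ k ∈ Finset.Icc 1 m, x ^ k / (k : ℝ) ∧
    -Real.log (1 - x) - ∑ k ∈ Finset.Icc 1 m, x ^ k / (k : ℝ) ≤ x ^ m * (-Real.log (1 - x)) := by
  have hs := Real.hasSum_pow_div_log_of_abs_lt_one (x := x) (by rwa [abs_of_nonneg hx0])
  have hfin : ∑ k ∈ Finset.Icc 1 m, x ^ k / (k : ℝ)
      = ∑ i ∈ Finset.range m, x ^ (i + 1) / ((i : ℝ) + 1) := by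
    rw [Finset.range_eq_Ico, ← Finset.Ico_add_one_right_eq_Icc,
      ← Finset.sum_Ico_add' (fun k : ℕ => x ^ k / (k : ℝ)) 0 m 1]
    simp
  have ht := (hasSum_nat_add_iff' m).2 hs
  rw [hfin]
  refine ⟨ht.nonneg fun i => by positivity, ?_⟩
  refine hasSum_le (fun i => ?_) ht (hs.mul_left (x ^ m))
  have e : x ^ (i + m + 1) = x ^ m * x ^ (i + 1) := by ring
  push_cast
  rw [e, ← mul_div_assoc]
  apply div_le_div_of_nonneg_left (by positivity) (by positivity)
  have : (0 : ℝ) ≤ m := by positivity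
  linarith

lemma trace_mul_pow_eq {n : ℕ} (R : Matrix (Fin n) (Fin n) ℝ) (hR : R.IsHermitian) (u : ℝ)
    (k : ℕ) : (R * (1 - u⁻¹ • R) ^ k).trace
      = ∑ i, hR.eigenvalues i * (1 - u⁻¹ * hR.eigenvalues i) ^ k := by
  have h := hR.spectral_theorem
  have h2 : R * (1 - u⁻¹ • R) ^ k = Unitary.conjStarAlgAut ℝ _ hR.eigenvectorUnitary
      (diagonal fun i => hR.eigenvalues i * (1 - u⁻¹ * hR.eigenvalues i) ^ k) := by
    have hd : (diagonal fun i => hR.eigenvalues i * (1 - u⁻¹ * hR.eigenvalues i) ^ k)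
        = diagonal hR.eigenvalues * (1 - u⁻¹ • diagonal hR.eigenvalues) ^ k := by
      rw [← diagonal_one, ← diagonal_smul, diagonal_sub, diagonal_pow, diagonal_mul_diagonal]
      rfl
    have h' : R = Unitary.conjStarAlgAut ℝ _ hR.eigenvectorUnitary
        (diagonal hR.eigenvalues) := h
    rw [hd, map_mul, map_pow, map_sub, map_one, map_smul, ← h']
  rw [h2, Unitary.conjStarAlgAut_apply, trace_mul_comm, ← mul_assoc, Unitary.coe_star_mul_self,
    one_mul, trace_diagonal]

/-- Truncated Taylor approximation of the von Neumann entropy: if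
`m ≥ (u/ℓ)·ln(1/ε)` then
`|H(R) − (ln(1/u) + ∑_{k=1}^m tr(R C^k)/k)| ≤ ε·H(R)`. -/
theorem truncated_taylor_entropy_bound {n : ℕ} (R : Matrix (Fin n) (Fin n) ℝ)
    (hR : R.PosDef) (htr : R.trace = 1) (ℓ u : ℝ)
    (hℓ : 0 < ℓ) (hℓu : ℓ ≤ u) (hu : u ≤ 1)
    (heig : ∀ i, hR.1.eigenvalues i ∈ Set.Icc ℓ u)
    (C : Matrix (Fin n) (Fin n) ℝ) (hC : C = 1 - u⁻¹ • R)
    (ε : ℝ) (hε : ε ∈ Set.Ioo (0 : ℝ) 1)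
    (m : ℕ) (hm : u / ℓ * Real.log (1 / ε) ≤ m) :
    |(-∑ i, hR.1.eigenvalues i * Real.log (hR.1.eigenvalues i)) -
        (Real.log (1 / u) + ∑ k ∈ Finset.Icc 1 m, (R * C ^ k).trace / k)| ≤
      ε * (-∑ i, hR.1.eigenvalues i * Real.log (hR.1.eigenvalues i)) := by
  subst hC
  have hu0 : 0 < u := hℓ.trans_le hℓu
  have hsum : ∑ i, hR.1.eigenvalues i = 1 := by
    have := hR.1.trace_eq_sum_eigenvalues
    rw [htr] at this
    simpa using this.symm
  simp only [trace_mul_pow_eq R hR.1]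
  generalize hR.1.eigenvalues = a at *
  have hx : ∀ i, 0 ≤ 1 - u⁻¹ * a i ∧ 1 - u⁻¹ * a i < 1 := by
    intro i
    obtain ⟨h1, h2⟩ := heig i
    have h3 : u⁻¹ * a i ≤ 1 := by rw [inv_mul_le_iff₀ hu0]; linarith
    have h4 : 0 < u⁻¹ * a i := mul_pos (inv_pos.2 hu0) (by linarith)
    constructor <;> linarith
  have hlog : ∀ i, Real.log (1 - (1 - u⁻¹ * a i)) = Real.log (a i) - Real.log u := by
    intro i
    have : 0 < a i := hℓ.trans_le (heig i).1
    rw [sub_sub_cancel, Real.log_mul (by positivity) (by positivity), Real.log_inv]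
    ring
  have hlogu : Real.log u ≤ 0 := Real.log_nonpos hu0.le hu
  have hpow : ∀ i, (1 - u⁻¹ * a i) ^ m ≤ ε := by
    intro i
    have h1 : 1 - u⁻¹ * a i ≤ Real.exp (-(ℓ / u)) := by
      have := Real.add_one_le_exp (-(ℓ / u))
      have h2 : ℓ / u ≤ u⁻¹ * a i := by
        rw [div_eq_inv_mul]
        exact mul_le_mul_of_nonneg_left (heig i).1 (inv_pos.2 hu0).le
      linarith
    calc _ ≤ Real.exp (-(ℓ / u)) ^ m := pow_le_pow_left₀ (hx i).1 h1 m
      _ = Real.exp (m * -(ℓ / u)) := (Real.exp_nat_mul _ _).symm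
      _ ≤ Real.exp (Real.log ε) := by
        apply Real.exp_le_exp.2
        rw [one_div, Real.log_inv] at hm
        have h3 := mul_le_mul_of_nonneg_left hm (div_pos hℓ hu0).le
        have h4 : ℓ / u * (u / ℓ * -Real.log ε) = -Real.log ε := by field_simp
        linarith
      _ = ε := Real.exp_log hε.1
  have key : (-∑ i, a i * Real.log (a i)) -
      (Real.log (1 / u) + ∑ k ∈ Finset.Icc 1 m, (∑ i, a i * (1 - u⁻¹ * a i) ^ k) / (k : ℝ))
      = ∑ i, a i * (-Real.log (1 - (1 - u⁻¹ * a i)) -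
        ∑ k ∈ Finset.Icc 1 m, (1 - u⁻¹ * a i) ^ k / (k : ℝ)) := by
    have e1 : ∑ k ∈ Finset.Icc 1 m, (∑ i, a i * (1 - u⁻¹ * a i) ^ k) / (k : ℝ)
        = ∑ i, a i * ∑ k ∈ Finset.Icc 1 m, (1 - u⁻¹ * a i) ^ k / (k : ℝ) := by
      simp only [Finset.sum_div, Finset.mul_sum]
      rw [Finset.sum_comm]
      simp only [mul_div_assoc]
    have e2 : Real.log (1 / u) = - ∑ i, a i * Real.log u := by
      rw [← Finset.sum_mul, hsum, one_div, Real.log_inv, one_mul]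
    rw [e1, e2]
    simp only [hlog, mul_sub, mul_neg, Finset.sum_sub_distrib, Finset.sum_neg_distrib]
    ring
  rw [key, ← Finset.sum_neg_distrib, Finset.mul_sum, abs_of_nonneg]
  · apply Finset.sum_le_sum
    intro i _
    have ha : 0 < a i := hℓ.trans_le (heig i).1
    have h1 := (scalar_taylor_bound _ (hx i).1 (hx i).2 m).2
    have h2 : 0 ≤ -Real.log (1 - (1 - u⁻¹ * a i)) := by
      have := Real.log_nonpos (x := 1 - (1 - u⁻¹ * a i)) (by linarith [(hx i).2])
        (by linarith [(hx i).1])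
      linarith
    have h3 := mul_le_mul_of_nonneg_right (hpow i) h2
    have h4 : ε * (-Real.log (1 - (1 - u⁻¹ * a i))) ≤ ε * (-Real.log (a i)) :=
      mul_le_mul_of_nonneg_left (by rw [hlog]; linarith) hε.1.le
    have h5 := mul_le_mul_of_nonneg_left (h1.trans (h3.trans h4)) ha.le
    calc _ ≤ _ := h5
      _ = _ := by ring
  · exact Finset.sum_nonneg fun i _ => mul_nonneg (hℓ.le.trans (heig i).1)
      (scalar_taylor_bound _ (hx i).1 (hx i).2 m).1
end

section
/- (Deterministic core of Theorem 1.) Let R be an n×n real symmetric positive definite matrix with unit trace whose eigenvalues lie in [ℓ, u] with 0 < ℓ ≤ u ≤ 1, let C = I_n − u⁻¹R, let ε ∈ (0, 1), and set m = ⌈(u/ℓ)·ln(1/ε)⌉. Suppose T̃ ∈ ℝ is any number satisfying the relative trace-estimation guarantee | T̃ − tr( Σ_{k=1}^m R C^k / k ) | ≤ ε · tr( Σ_{k=1}^m R C^k / k ). Then the estimate Ĥ = ln(1/u) + T̃ satisfies | Ĥ − H(R) | ≤ 2ε · H(R). -/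
open Matrix

lemma scalar_tail (x : ℝ) (h0 : 0 ≤ x) (h1 : x < 1) (m : ℕ) :
    ∑ k ∈ Finset.Icc 1 m, ((k : ℝ))⁻¹ * x ^ k ≤ -Real.log (1 - x) ∧
    -Real.log (1 - x) - ∑ k ∈ Finset.Icc 1 m, ((k : ℝ))⁻¹ * x ^ k
      ≤ x ^ m * (-Real.log (1 - x)) := by
  have hs := Real.hasSum_pow_div_log_of_abs_lt_one (x := x) (by rw [abs_of_nonneg h0]; exact h1)
  have hP : ∑ k ∈ Finset.Icc 1 m, ((k : ℝ))⁻¹ * x ^ k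
      = ∑ k ∈ Finset.range m, x ^ (k + 1) / ((k : ℝ) + 1) := by
    rw [Finset.range_eq_Ico, ← Finset.Ico_add_one_right_eq_Icc, 
      Finset.sum_Ico_eq_sum_range, ← Finset.range_eq_Ico]
    refine Finset.sum_congr rfl fun k _ => ?_
    push_cast
    rw [add_comm 1 k, add_comm 1 (k : ℝ)]
    ring
  rw [hP]
  constructor
  · exact sum_le_hasSum _ (fun i _ => by positivity) hs
  · have h2 := (hasSum_nat_add_iff' m).2 hs
    have h3 := hs.mul_left (x ^ m)
    refine hasSum_le (fun k => ?_) h2 h3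
    rw [← mul_div_assoc, ← pow_add]
    rw [show m + (k + 1) = k + m + 1 by ring]
    push_cast
    apply div_le_div_of_nonneg_left (by positivity) (by positivity)
    have : (0 : ℝ) ≤ m := by positivity
    linarith

lemma trace_R_pow {n : ℕ} (R : Matrix (Fin n) (Fin n) ℝ) (hR : R.IsHermitian) (c : ℝ) (k : ℕ) :
    (R * (1 - c • R) ^ k).trace
      = ∑ i, hR.eigenvalues i * (1 - c * hR.eigenvalues i) ^ k := by
  have hsp := hR.spectral_theorem
  set φ := Unitary.conjStarAlgAut ℝ (Matrix (Fin n) (Fin n) ℝ) hR.eigenvectorUnitary with hφ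
  set D : Matrix (Fin n) (Fin n) ℝ := diagonal (RCLike.ofReal ∘ hR.eigenvalues) with hD
  have h1 : R * (1 - c • R) ^ k = φ (D * (1 - c • D) ^ k) := by
    rw [map_mul, map_pow, map_sub, map_smul, map_one, ← hsp]
  have htr : ∀ X, (φ X).trace = X.trace := by
    intro X
    rw [hφ, Unitary.conjStarAlgAut_apply, Matrix.trace_mul_cycle]
    simp
  have h2 : D * (1 - c • D) ^ k
      = diagonal (fun i => hR.eigenvalues i * (1 - c * hR.eigenvalues i) ^ k) := by
    have : (1 - c • D) = diagonal (fun i => 1 - c * hR.eigenvalues i) := by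
      rw [hD, ← diagonal_one, ← diagonal_smul, diagonal_sub]
      rfl
    rw [this, diagonal_pow, hD, diagonal_mul_diagonal]
    rfl
  rw [h1, htr, h2, trace_diagonal]

/-- Deterministic core of Theorem 1: with `m = ⌈(u/ℓ)·ln(1/ε)⌉`, if `T̃` satisfies the
relative trace-estimation guarantee for `tr(∑_{k=1}^m R C^k / k)`, then
`Ĥ = ln(1/u) + T̃` satisfies `|Ĥ − H(R)| ≤ 2ε·H(R)`. -/
theorem taylor_entropy_estimate_bound {n : ℕ} (R : Matrix (Fin n) (Fin n) ℝ)
    (hR : R.PosDef) (htr : R.trace = 1) (ℓ u : ℝ)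
    (hℓ : 0 < ℓ) (hℓu : ℓ ≤ u) (hu : u ≤ 1)
    (heig : ∀ i, hR.1.eigenvalues i ∈ Set.Icc ℓ u)
    (C : Matrix (Fin n) (Fin n) ℝ) (hC : C = 1 - u⁻¹ • R)
    (ε : ℝ) (hε : ε ∈ Set.Ioo (0 : ℝ) 1)
    (m : ℕ) (hm : m = ⌈u / ℓ * Real.log (1 / ε)⌉₊)
    (Ttil : ℝ)
    (hTtil : |Ttil - (∑ k ∈ Finset.Icc 1 m, ((k : ℝ))⁻¹ • (R * C ^ k)).trace| ≤
      ε * (∑ k ∈ Finset.Icc 1 m, ((k : ℝ))⁻¹ • (R * C ^ k)).trace) :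
    |(Real.log (1 / u) + Ttil) -
        (-∑ i, hR.1.eigenvalues i * Real.log (hR.1.eigenvalues i))| ≤
      2 * ε * (-∑ i, hR.1.eigenvalues i * Real.log (hR.1.eigenvalues i)) := by
  have hu0 : 0 < u := lt_of_lt_of_le hℓ hℓu
  obtain ⟨hε0, hε1⟩ := hε
  set lam := hR.1.eigenvalues with hlam
  have hsum : ∑ i, lam i = 1 := by
    have := trace_R_pow R hR.1 0 0
    simp only [pow_zero, mul_one] at this
    rw [← htr, this]
  set T := (∑ k ∈ Finset.Icc 1 m, ((k : ℝ))⁻¹ • (R * C ^ k)).trace with hT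
  have hTeq : T = ∑ i, lam i * ∑ k ∈ Finset.Icc 1 m, ((k : ℝ))⁻¹ * (1 - u⁻¹ * lam i) ^ k := by
    rw [hT, hC, trace_sum]
    simp_rw [trace_smul, trace_R_pow R hR.1, smul_eq_mul, Finset.mul_sum]
    rw [Finset.sum_comm]
    refine Finset.sum_congr rfl fun i _ => Finset.sum_congr rfl fun k _ => ?_
    rw [← hlam]; ring
  set S := ∑ i, lam i * (-Real.log (1 - (1 - u⁻¹ * lam i))) with hS
  have hlogu : 0 ≤ Real.log (1 / u) := Real.log_nonneg (by rw [le_div_iff₀ hu0]; linarith)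
  have hH : (-∑ i, lam i * Real.log (lam i)) = Real.log (1 / u) + S := by
    have h1 : ∀ i, lam i * (-Real.log (1 - (1 - u⁻¹ * lam i)))
        = -(lam i * Real.log (lam i)) - lam i * Real.log (1 / u) := by
      intro i
      have hi : 0 < lam i := lt_of_lt_of_le hℓ (heig i).1
      rw [sub_sub_cancel, Real.log_mul (by positivity) hi.ne', one_div]
      ring
    rw [hS]
    simp_rw [h1]
    rw [Finset.sum_sub_distrib, ← Finset.sum_mul, hsum, Finset.sum_neg_distrib]
    ring
  have hx : ∀ i, 0 ≤ 1 - u⁻¹ * lam i ∧ 1 - u⁻¹ * lam i < 1 ∧ (1 - u⁻¹ * lam i) ^ m ≤ ε := by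
    intro i
    obtain ⟨ha, hb⟩ := heig i
    have hi : 0 < lam i := lt_of_lt_of_le hℓ ha
    have h0 : 0 ≤ 1 - u⁻¹ * lam i := by
      have : u⁻¹ * lam i ≤ 1 := by rw [inv_mul_le_iff₀ hu0]; linarith
      linarith
    have hpos : 0 < u⁻¹ * lam i := by positivity
    refine ⟨h0, by linarith, ?_⟩
    have hle : 1 - u⁻¹ * lam i ≤ Real.exp (-(ℓ / u)) := by
      have h2 : ℓ / u ≤ u⁻¹ * lam i := by
        rw [div_eq_inv_mul]; gcongr
      have := Real.add_one_le_exp (-(ℓ / u))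
      linarith
    calc (1 - u⁻¹ * lam i) ^ m ≤ Real.exp (-(ℓ / u)) ^ m := by gcongr
      _ = Real.exp (m * (-(ℓ / u))) := (Real.exp_nat_mul _ _).symm
      _ ≤ Real.exp (Real.log ε) := by
        apply Real.exp_le_exp.2
        have h3 : u / ℓ * Real.log (1 / ε) ≤ m := by rw [hm]; exact Nat.le_ceil _
        have h4 : (u / ℓ * Real.log (1 / ε)) * (ℓ / u) ≤ m * (ℓ / u) := by gcongr
        have h5 : (u / ℓ * Real.log (1 / ε)) * (ℓ / u) = - Real.log ε := by
          rw [one_div, Real.log_inv]; field_simp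
        linarith
      _ = ε := Real.exp_log hε0
  have hTS : T ≤ S := by
    rw [hTeq, hS]
    refine Finset.sum_le_sum fun i _ => ?_
    have hi : 0 < lam i := lt_of_lt_of_le hℓ (heig i).1
    exact mul_le_mul_of_nonneg_left (scalar_tail _ (hx i).1 (hx i).2.1 m).1 hi.le
  have hST : S - T ≤ ε * S := by
    rw [hTeq, hS, ← Finset.sum_sub_distrib, Finset.mul_sum]
    refine Finset.sum_le_sum fun i _ => ?_
    have hi : 0 < lam i := lt_of_lt_of_le hℓ (heig i).1
    have hL : 0 ≤ -Real.log (1 - (1 - u⁻¹ * lam i)) := by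
      have := Real.log_nonpos (x := 1 - (1 - u⁻¹ * lam i))
        (by linarith [(hx i).2.1]) (by linarith [(hx i).1])
      linarith
    have h1 := (scalar_tail _ (hx i).1 (hx i).2.1 m).2
    have h2 := mul_le_mul_of_nonneg_right (hx i).2.2 hL
    have h3 := mul_le_mul_of_nonneg_left (h1.trans h2) hi.le
    linarith
  rw [hH]
  rw [abs_le] at hTtil ⊢
  have h6 : ε * T ≤ ε * S := by gcongr
  have h7 : 0 ≤ ε * Real.log (1 / u) := by positivity
  constructor <;> linarith [hTtil.1, hTtil.2]
end

section
/- Let u > 0 and let m ≥ 1 be an integer. For every x ∈ [0, u], the Chebyshev approximant f_m satisfies | h(x) − f_m(x) | ≤ u / (2m(m+1)) ≤ u / (2m²), where h(x) = x ln x for x > 0 and h(0) = 0. -/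
open Polynomial

/-- The Chebyshev coefficients `α_w` used in the approximation of `h(x) = x ln x`
on `[0, u]`: `α_0 = (u/2)(ln(u/4)+1)`, `α_1 = (u/4)(2 ln(u/4)+3)`,
`α_w = (−1)^w u/(w³−w)` for `w ≥ 2`. -/
noncomputable def chebCoef (u : ℝ) : ℕ → ℝ
  | 0 => u / 2 * (Real.log (u / 4) + 1)
  | 1 => u / 4 * (2 * Real.log (u / 4) + 3)
  | (w + 2) => (-1 : ℝ) ^ (w + 2) * u / (((w + 2 : ℕ) : ℝ) ^ 3 - ((w + 2 : ℕ) : ℝ))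

/-- The degree-`m` Chebyshev approximant `f_m(x) = ∑_{w=0}^m α_w T_w((2/u)x − 1)`
of `h(x) = x ln x` on `[0, u]`. -/
noncomputable def chebApprox (u : ℝ) (m : ℕ) (x : ℝ) : ℝ :=
  ∑ w ∈ Finset.range (m + 1),
    chebCoef u w * (Polynomial.Chebyshev.T ℝ (w : ℤ)).eval (2 / u * x - 1)

/-- General term of the complexified series. -/
noncomputable def auxTerm (z : ℂ) (n : ℕ) : ℂ :=
  (-1) ^ n * z ^ (n + 2) / (((n + 2 : ℕ) : ℂ) ^ 3 - ((n + 2 : ℕ) : ℂ))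

/-- Closed form of the complexified series. -/
noncomputable def auxG (z : ℂ) : ℂ :=
  1 / 2 * ((z + 1) ^ 2 / z) * Complex.log (1 + z) - 1 / 2 - 3 / 4 * z

lemma auxTerm_hasSum (z : ℂ) (hz : ‖z‖ < 1) (h0 : z ≠ 0) : HasSum (auxTerm z) (auxG z) := by
  have h := Complex.hasSum_taylorSeries_log hz
  have h1 := (hasSum_nat_add_iff' 1).2 h
  have h2 := (hasSum_nat_add_iff' 2).2 h
  have h3 := (hasSum_nat_add_iff' 3).2 h
  have H := (((h1.mul_left z).add (h3.mul_left z⁻¹)).mul_left (1 / 2)).add h2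
  refine Eq.mp (congrArg₂ (fun f a => HasSum f a) ?_ ?_) H
  · funext n
    symm
    unfold auxTerm
    have e1 : ((n : ℂ) + 1) ≠ 0 := by exact_mod_cast Nat.succ_ne_zero n
    have e2 : ((n : ℂ) + 2) ≠ 0 := by exact_mod_cast Nat.succ_ne_zero (n + 1)
    have e3 : ((n : ℂ) + 3) ≠ 0 := by exact_mod_cast Nat.succ_ne_zero (n + 2)
    push_cast
    have e : ((n : ℂ) + 2) ^ 3 - (n + 2) = (n + 1) * (n + 2) * (n + 3) := by ring
    rw [e]
    field_simp
    ring
  · symm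
    unfold auxG
    simp [Finset.sum_range_succ]
    field_simp
    ring

lemma auxTerm_norm (z : ℂ) (hz : ‖z‖ ≤ 1) (n : ℕ) :
    ‖auxTerm z n‖ ≤ 1 / (2 * ((n : ℝ) + 1) * (n + 2)) - 1 / (2 * ((n : ℝ) + 2) * (n + 3)) := by
  unfold auxTerm
  have e : (((n + 2 : ℕ) : ℂ) ^ 3 - ((n + 2 : ℕ) : ℂ)) =
      (((n + 1) * (n + 2) * (n + 3) : ℕ) : ℂ) := by push_cast; ring
  rw [e, norm_div, Complex.norm_natCast, norm_mul, norm_pow, norm_pow, norm_neg, norm_one,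
    one_pow, one_mul]
  have : 1 / (2 * ((n : ℝ) + 1) * (n + 2)) - 1 / (2 * ((n : ℝ) + 2) * (n + 3))
     = 1 / (((n + 1) * (n + 2) * (n + 3) : ℕ) : ℝ) := by
    push_cast; field_simp; ring
  rw [this]
  gcongr
  exact pow_le_one₀ (norm_nonneg _) hz

lemma aux_partial (z : ℂ) (hz : ‖z‖ ≤ 1) (k j : ℕ) :
    ‖∑ n ∈ Finset.range (k + j), auxTerm z n - ∑ n ∈ Finset.range k, auxTerm z n‖ ≤
      1 / (2 * ((k : ℝ) + 1) * (k + 2)) - 1 / (2 * (((k + j : ℕ) : ℝ) + 1) * ((k + j : ℕ) + 2)) := by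
  induction j with
  | zero => simp
  | succ j ih =>
    rw [← add_assoc, Finset.sum_range_succ, add_sub_right_comm]
    refine (norm_add_le _ _).trans ?_
    have := auxTerm_norm z hz (k + j)
    have e : (((k + j + 1 : ℕ) : ℝ) + 1) = ((k + j : ℕ) : ℝ) + 2 := by push_cast; ring
    have e' : (((k + j + 1 : ℕ) : ℝ) + 2) = ((k + j : ℕ) : ℝ) + 3 := by push_cast; ring
    rw [e, e']
    linarith

lemma aux_bound_lt (z : ℂ) (hz : ‖z‖ < 1) (h0 : z ≠ 0) (k : ℕ) :
    ‖auxG z - ∑ n ∈ Finset.range k, auxTerm z n‖ ≤ 1 / (2 * ((k : ℝ) + 1) * (k + 2)) := by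
  have h := (auxTerm_hasSum z hz h0).tendsto_sum_nat
  have h' := ((h.comp (Filter.tendsto_add_atTop_nat k)).sub_const
    (∑ n ∈ Finset.range k, auxTerm z n)).norm
  refine le_of_tendsto' h' fun j => ?_
  have := aux_partial z hz.le k j
  simp only [Function.comp]
  rw [add_comm j k]
  refine this.trans ?_
  have : 0 ≤ 1 / (2 * (((k + j : ℕ) : ℝ) + 1) * ((k + j : ℕ) + 2)) := by positivity
  linarith

lemma aux_bound (z : ℂ) (hz : ‖z‖ = 1) (h1 : 1 + z ∈ Complex.slitPlane) (k : ℕ) :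
    ‖auxG z - ∑ n ∈ Finset.range k, auxTerm z n‖ ≤ 1 / (2 * ((k : ℝ) + 1) * (k + 2)) := by
  have h0 : z ≠ 0 := by rintro rfl; simp at hz
  have hc : ContinuousAt (fun z => ‖auxG z - ∑ n ∈ Finset.range k, auxTerm z n‖) z := by
    unfold auxG auxTerm
    have hl : ContinuousAt (fun z : ℂ => Complex.log (1 + z)) z :=
      ContinuousAt.clog (by fun_prop) h1
    have hd : ContinuousAt (fun z : ℂ => (z + 1) ^ 2 / z) z :=
      ContinuousAt.div (by fun_prop) (by fun_prop) h0
    refine ContinuousAt.norm (ContinuousAt.sub ?_ (by fun_prop))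
    exact (((continuousAt_const.mul hd).mul hl).sub continuousAt_const).sub (by fun_prop)
  have ht : Filter.Tendsto (fun r : ℝ => (r : ℂ) * z) (nhdsWithin 1 (Set.Ioo 0 1)) (nhds z) := by
    have : ContinuousAt (fun r : ℝ => (r : ℂ) * z) 1 := by fun_prop
    have := this.tendsto
    simp only [Complex.ofReal_one, one_mul] at this
    exact this.mono_left nhdsWithin_le_nhds
  have : (nhdsWithin (1 : ℝ) (Set.Ioo 0 1)).NeBot := by
    rw [← mem_closure_iff_nhdsWithin_neBot, closure_Ioo (by norm_num)]
    simp
  refine le_of_tendsto (hc.tendsto.comp ht) ?_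
  filter_upwards [self_mem_nhdsWithin] with r hr
  refine aux_bound_lt _ ?_ ?_ k
  · rw [norm_mul, hz, Complex.norm_real, Real.norm_eq_abs, abs_of_pos hr.1, mul_one]
    exact hr.2
  · exact mul_ne_zero (by exact_mod_cast hr.1.ne') h0

lemma aux_main (u : ℝ) (hu : 0 < u) (k : ℕ) (x : ℝ) (hx0 : 0 < x) (hxu : x ≤ u) :
    |x * Real.log x - chebApprox u (k + 1) x| ≤ u * (1 / (2 * ((k : ℝ) + 1) * (k + 2))) := by
  set c : ℝ := 2 / u * x - 1 with hc
  have hxc : x = u * ((1 + c) / 2) := by rw [hc]; field_simp; ring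
  have hc1 : 0 < 1 + c := by rw [hc]; have : 0 < 2 / u * x := by positivity
                             linarith
  have hc2 : c ≤ 1 := by
    have : x / u ≤ 1 := (div_le_one hu).2 hxu
    rw [hc]
    have e : 2 / u * x = 2 * (x / u) := by ring
    linarith
  set θ := Real.arccos c with hθ
  have hcos : Real.cos θ = c := Real.cos_arccos (by linarith) hc2
  set z : ℂ := Complex.exp (θ * Complex.I) with hz
  have hzn : ‖z‖ = 1 := Complex.norm_exp_ofReal_mul_I θ
  have h0 : z ≠ 0 := Complex.exp_ne_zero _
  have hpow : ∀ n : ℕ, (z ^ n).re = Real.cos (n * θ) := by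
    intro n
    rw [hz, ← Complex.exp_nat_mul, ← mul_assoc]
    have := Complex.exp_ofReal_mul_I_re (n * θ)
    push_cast at this
    exact this
  have hzre : z.re = c := by have := hpow 1; simpa [hcos] using this
  have hzim : z.re ^ 2 + z.im ^ 2 = 1 := by
    have : Complex.normSq z = 1 := by rw [Complex.normSq_eq_norm_sq, hzn]; norm_num
    rw [Complex.normSq_apply] at this
    linarith
  have hslit : 1 + z ∈ Complex.slitPlane := by
    left; simp [hzre]; exact hc1
  have hB := aux_bound z hzn hslit k
  have hre := (Complex.abs_re_le_norm _).trans hB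
  have hquot : (z + 1) ^ 2 / z = ((2 + 2 * c : ℝ) : ℂ) := by
    rw [div_eq_iff h0]
    apply Complex.ext
    · simp [pow_two, ← hzre]; nlinarith
    · simp [pow_two, ← hzre]; ring
  have hlog : (Complex.log (1 + z)).re = 1 / 2 * Real.log (2 + 2 * c) := by
    rw [Complex.log_re]
    have : 2 + 2 * c = ‖1 + z‖ ^ 2 := by
      rw [← Complex.normSq_eq_norm_sq, Complex.normSq_apply, ← hzre]
      simp; nlinarith
    rw [this, Real.log_pow]; push_cast; ring
  have hG : (auxG z).re = (1 + c) / 2 * Real.log (2 + 2 * c) - 1 / 2 - 3 / 4 * c := by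
    unfold auxG
    rw [hquot]
    have e : (1 / 2 * ((2 + 2 * c : ℝ) : ℂ) * Complex.log (1 + z) - 1 / 2 - 3 / 4 * z) =
      ((1 + c : ℝ) : ℂ) * Complex.log (1 + z) - ((1 / 2 : ℝ) : ℂ) - ((3 / 4 : ℝ) : ℂ) * z := by
      push_cast; ring
    rw [e, Complex.sub_re, Complex.sub_re, Complex.re_ofReal_mul, Complex.re_ofReal_mul,
      Complex.ofReal_re, hlog, hzre]
    ring
  have hT : ∀ n : ℕ, u * (auxTerm z n).re =
      chebCoef u (n + 2) * (Polynomial.Chebyshev.T ℝ ((n + 2 : ℕ) : ℤ)).eval c := by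
    intro n
    have e : auxTerm z n = (((-1) ^ n / (((n + 2 : ℕ) : ℝ) ^ 3 - ((n + 2 : ℕ) : ℝ)) : ℝ) : ℂ)
        * z ^ (n + 2) := by
      unfold auxTerm; push_cast; ring
    rw [e, Complex.re_ofReal_mul, hpow, ← hcos, Polynomial.Chebyshev.T_real_cos]
    simp only [chebCoef]
    push_cast
    ring
  have hlogx : Real.log x = Real.log (u / 4) + Real.log (2 + 2 * c) := by
    rw [← Real.log_mul (by positivity) (by linarith)]
    congr 1
    rw [hxc]; ring
  have key : x * Real.log x - chebApprox u (k + 1) x =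
      u * (auxG z - ∑ n ∈ Finset.range k, auxTerm z n).re := by
    unfold chebApprox
    rw [Finset.sum_range_succ', Finset.sum_range_succ', Complex.sub_re, Complex.re_sum, mul_sub,
      Finset.mul_sum, hG, hlogx, ← hc]
    rw [Finset.sum_congr rfl (fun n _ => hT n)]
    generalize hS : (∑ n ∈ Finset.range k,
      chebCoef u (n + 2) * (Polynomial.Chebyshev.T ℝ ((n + 2 : ℕ) : ℤ)).eval c) = S
    simp [chebCoef]
    rw [hxc]
    ring
  rw [key, abs_mul, abs_of_pos hu]
  gcongr

/-- Chebyshev approximation error bound (Lemma 3 of the paper, after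
Proposition 3.1 of Wihler et al.): for `x ∈ [0, u]`,
`|h(x) − f_m(x)| ≤ u/(2m(m+1)) ≤ u/(2m²)`, where `h(x) = x ln x`, `h(0) = 0`. -/
theorem chebApprox_error_bound (u : ℝ) (hu : 0 < u) (m : ℕ) (hm : 1 ≤ m)
    (x : ℝ) (hx : x ∈ Set.Icc 0 u) :
    |x * Real.log x - chebApprox u m x| ≤ u / (2 * m * (m + 1)) ∧
      u / (2 * m * (m + 1)) ≤ u / (2 * m ^ 2) := by
  obtain ⟨k, rfl⟩ : ∃ k, m = k + 1 := ⟨m - 1, by omega⟩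
  constructor
  · have hcl : IsClosed {y : ℝ | |y * Real.log y - chebApprox u (k + 1) y| ≤
        u * (1 / (2 * ((k : ℝ) + 1) * (k + 2)))} := by
      refine isClosed_le ?_ continuous_const
      refine (Real.continuous_mul_log.sub ?_).abs
      unfold chebApprox
      fun_prop
    have hsub : Set.Ioo 0 u ⊆ {y : ℝ | |y * Real.log y - chebApprox u (k + 1) y| ≤
        u * (1 / (2 * ((k : ℝ) + 1) * (k + 2)))} :=
      fun y hy => aux_main u hu k y hy.1 hy.2.le
    have := closure_minimal hsub hcl
    rw [closure_Ioo hu.ne] at this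
    refine (this hx).trans (le_of_eq ?_)
    push_cast
    rw [mul_one_div]
    congr 1
    ring
  · have : (0 : ℝ) < ((k + 1 : ℕ) : ℝ) := by positivity
    apply div_le_div_of_nonneg_left hu.le (by positivity)
    nlinarith
end

section
/- Let u > 0, let m ≥ 1 be an integer, and let p_1, …, p_n ∈ [0, u]. Then | Σ_{i=1}^n p_i ln(1/p_i) − Σ_{i=1}^n (−f_m(p_i)) | ≤ n·u / (2m²), where the convention 0·ln(1/0) = 0 is used. -/
open Polynomial

/-- Coefficients of the Taylor series of `log (1+z)`. -/
noncomputable def bco (n : ℕ) : ℝ := (-1) ^ (n + 1) / n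

/-- Shifted coefficients of `(1+z)^2/z * log(1+z)`. -/
noncomputable def gco (n : ℕ) : ℝ := bco n + 2 * bco (n + 1) + bco (n + 2)

noncomputable def gsum (z : ℂ) (N : ℕ) : ℂ := 1 + ∑ w ∈ Finset.range N, (gco w : ℂ) * z ^ (w + 1)

lemma gco_succ (k : ℕ) :
    gco (k + 1) = (-1) ^ k * (2 / (((k : ℝ) + 1) * (k + 2) * (k + 3))) := by
  unfold gco bco
  push_cast
  have h1 : (k : ℝ) + 1 ≠ 0 := by positivity
  have h2 : (k : ℝ) + 2 ≠ 0 := by positivity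
  have h3 : (k : ℝ) + 3 ≠ 0 := by positivity
  have e2 : (k : ℝ) + 1 + 1 = k + 2 := by ring
  have e3 : (k : ℝ) + 1 + 2 = k + 3 := by ring
  rw [e2, e3]
  field_simp
  ring

lemma chebCoef_two (u : ℝ) (k : ℕ) : chebCoef u (k + 2) = u / 2 * gco (k + 1) := by
  rw [gco_succ]
  simp only [chebCoef]
  push_cast
  have h1 : (k : ℝ) + 1 ≠ 0 := by positivity
  have h2 : (k : ℝ) + 2 ≠ 0 := by positivity
  have h3 : (k : ℝ) + 3 ≠ 0 := by positivity
  have e : ((k : ℝ) + 2) ^ 3 - (k + 2) = (k + 1) * (k + 2) * (k + 3) := by ring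
  rw [e]
  field_simp
  ring

lemma partial_identity (z : ℂ) (N : ℕ) :
    (1 + z) ^ 2 * ∑ n ∈ Finset.range (N + 2), (bco n : ℂ) * z ^ n =
      z * gsum z N + ((bco N : ℂ) * z ^ N * z ^ 2
        + 2 * ((bco (N + 1) : ℂ) * z ^ (N + 1)) * z + (bco (N + 1) : ℂ) * z ^ (N + 1) * z ^ 2) := by
  induction N with
  | zero => simp [gsum, bco, Finset.sum_range_succ]; ring
  | succ N ih =>
    rw [Finset.sum_range_succ, mul_add, ih]
    unfold gsum
    rw [Finset.sum_range_succ]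
    simp only [gco]
    push_cast
    ring

lemma gsum_tail (z : ℂ) (hz : ‖z‖ ≤ 1) (m N : ℕ) (hm : 1 ≤ m) (hN : m ≤ N) :
    ‖gsum z N - gsum z m‖ ≤ 1 / ((m : ℝ) * (m + 1)) - 1 / ((N : ℝ) * (N + 1)) := by
  induction N, hN using Nat.le_induction with
  | base => simp
  | succ N hN ih =>
    have e : gsum z (N + 1) - gsum z m = (gsum z N - gsum z m) + (gco N : ℂ) * z ^ (N + 1) := by
      unfold gsum; rw [Finset.sum_range_succ]; ring
    rw [e]
    refine (norm_add_le _ _).trans ?_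
    have hz' : ‖z‖ ^ (N + 1) ≤ 1 := pow_le_one₀ (norm_nonneg _) hz
    have hg : |gco N| = 1 / ((N : ℝ) * (N + 1)) - 1 / (((N + 1 : ℕ) : ℝ) * ((N + 1 : ℕ) + 1)) := by
      obtain ⟨k, rfl⟩ : ∃ k, N = k + 1 := ⟨N - 1, by omega⟩
      rw [gco_succ, abs_mul, abs_pow, abs_neg, abs_one, one_pow, one_mul, abs_of_nonneg (by positivity)]
      push_cast
      field_simp
      ring
    have h2 : ‖(gco N : ℂ) * z ^ (N + 1)‖ ≤ |gco N| := by
      rw [norm_mul, norm_pow, Complex.norm_real, Real.norm_eq_abs]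
      exact mul_le_of_le_one_right (abs_nonneg _) hz'
    linarith

lemma disc_bound (z : ℂ) (hz : ‖z‖ < 1) (m : ℕ) (hm : 1 ≤ m) :
    ‖(1 + z) ^ 2 * Complex.log (1 + z) - z * gsum z m‖ ≤ 1 / ((m : ℝ) * (m + 1)) := by
  have hs : HasSum (fun n : ℕ => (bco n : ℂ) * z ^ n) (Complex.log (1 + z)) := by
    convert Complex.hasSum_taylorSeries_log hz using 2 with n
    simp [bco]; ring
  have h0 := hs.summable.tendsto_atTop_zero
  have h0' := (Filter.tendsto_add_atTop_iff_nat 1).2 h0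
  have hS := (Filter.tendsto_add_atTop_iff_nat 2).2 hs.tendsto_sum_nat
  have herr := ((h0.mul_const (z ^ 2)).add ((h0'.const_mul 2).mul_const z)).add
    (h0'.mul_const (z ^ 2))
  have hG := (((hS.const_mul ((1 + z) ^ 2)).sub herr).sub_const (z * gsum z m)).norm
  simp only [mul_zero, zero_mul, add_zero, sub_zero] at hG
  refine le_of_tendsto hG ?_
  filter_upwards [Filter.eventually_ge_atTop m] with N hN
  rw [partial_identity, add_sub_cancel_right, ← mul_sub, norm_mul]
  have := gsum_tail z hz.le m N hm hN
  have h3 : 0 ≤ 1 / ((N : ℝ) * (N + 1)) := by positivity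
  calc ‖z‖ * _ ≤ 1 * ‖gsum z N - gsum z m‖ := by gcongr
    _ ≤ _ := by linarith

lemma circle_bound (z : ℂ) (hz : ‖z‖ = 1) (hre : 0 < 1 + z.re) (m : ℕ) (hm : 1 ≤ m) :
    ‖(1 + z) ^ 2 * Complex.log (1 + z) - z * gsum z m‖ ≤ 1 / ((m : ℝ) * (m + 1)) := by
  have hc : ContinuousAt (fun z : ℂ =>
      ‖(1 + z) ^ 2 * Complex.log (1 + z) - z * gsum z m‖) z := by
    have h1 : ContinuousAt (fun z : ℂ => Complex.log (1 + z)) z :=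
      ContinuousAt.clog (by fun_prop) (Or.inl (by simpa using hre))
    unfold gsum
    fun_prop
  have hcl : z ∈ closure (Metric.ball (0 : ℂ) 1) := by
    rw [closure_ball _ one_ne_zero]; simp [hz]
  have : (nhdsWithin z (Metric.ball (0 : ℂ) 1)).NeBot := mem_closure_iff_nhdsWithin_neBot.1 hcl
  refine le_of_tendsto (hc.tendsto.mono_left (nhdsWithin_le_nhds (s := Metric.ball (0 : ℂ) 1))) ?_
  filter_upwards [self_mem_nhdsWithin] with w hw
  exact disc_bound w (by simpa using hw) m hm

lemma cos_bound (θ : ℝ) (hre : 0 < 1 + Real.cos θ) (m : ℕ) (hm : 1 ≤ m) :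
    |(1 + Real.cos θ) * Real.log (2 + 2 * Real.cos θ)
      - (1 + ∑ w ∈ Finset.range m, gco w * Real.cos ((w + 1 : ℕ) * θ))| ≤
      1 / ((m : ℝ) * (m + 1)) := by
  set z : ℂ := Complex.exp (θ * Complex.I) with hzdef
  have hz : ‖z‖ = 1 := Complex.norm_exp_ofReal_mul_I θ
  have hzre : z.re = Real.cos θ := Complex.exp_ofReal_mul_I_re θ
  have hzim : z.im = Real.sin θ := Complex.exp_ofReal_mul_I_im θ
  have hb := circle_bound z hz (by rw [hzre]; exact hre) m hm
  have hz0 : z ≠ 0 := Complex.exp_ne_zero _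
  have hsc := Real.sin_sq_add_cos_sq θ
  have hsq : (1 + z) ^ 2 = z * ((2 + 2 * Real.cos θ : ℝ) : ℂ) := by
    apply Complex.ext
    · simp [pow_two, hzre, hzim, -Complex.ofReal_cos]; nlinarith
    · simp [pow_two, hzre, hzim, -Complex.ofReal_cos]; nlinarith
  rw [hsq, mul_assoc, ← mul_sub, norm_mul, hz, one_mul] at hb
  refine le_trans ?_ ((Complex.abs_re_le_norm _).trans hb)
  apply le_of_eq
  congr 1
  rw [Complex.sub_re, Complex.re_ofReal_mul, Complex.log_re]
  have hn : ‖1 + z‖ ^ 2 = 2 + 2 * Real.cos θ := by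
    rw [← Complex.normSq_eq_norm_sq, Complex.normSq_apply]
    simp [hzre, hzim]; nlinarith
  have hl : Real.log (2 + 2 * Real.cos θ) = 2 * Real.log ‖1 + z‖ := by
    rw [← hn, Real.log_pow]; norm_num
  rw [hl]
  have hg : (gsum z m).re = 1 + ∑ w ∈ Finset.range m, gco w * Real.cos ((w + 1 : ℕ) * θ) := by
    unfold gsum
    rw [Complex.add_re, Complex.re_sum, Complex.one_re]
    congr 1
    refine Finset.sum_congr rfl fun w _ => ?_
    rw [Complex.re_ofReal_mul, hzdef, ← Complex.exp_nat_mul]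
    rw [← Complex.exp_ofReal_mul_I_re]
    congr 3
    push_cast; ring
  rw [hg]; ring

lemma chebApprox_eq (u x : ℝ) (m : ℕ) (hm : 1 ≤ m) (θ : ℝ) (hθ : 2 / u * x - 1 = Real.cos θ) :
    chebApprox u m x = u / 2 * (Real.log (u / 4) * (1 + Real.cos θ) +
      (1 + ∑ w ∈ Finset.range m, gco w * Real.cos ((w + 1 : ℕ) * θ))) := by
  unfold chebApprox
  rw [hθ]
  simp only [Polynomial.Chebyshev.T_real_cos]
  induction m, hm using Nat.le_induction with
  | base =>
    simp [Finset.sum_range_succ, chebCoef, gco, bco]; ring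
  | succ m hm ih =>
    rw [Finset.sum_range_succ, ih, Finset.sum_range_succ]
    obtain ⟨k, rfl⟩ : ∃ k, m = k + 1 := ⟨m - 1, by omega⟩
    rw [chebCoef_two]
    push_cast
    ring

lemma zero_sum (m : ℕ) (hm : 1 ≤ m) :
    1 + ∑ w ∈ Finset.range m, gco w * Real.cos ((w + 1 : ℕ) * Real.pi) =
      - (1 / ((m : ℝ) * (m + 1))) := by
  induction m, hm using Nat.le_induction with
  | base => norm_num [gco, bco]
  | succ m hm ih =>
    rw [Finset.sum_range_succ, ← add_assoc, ih]
    obtain ⟨k, rfl⟩ : ∃ k, m = k + 1 := ⟨m - 1, by omega⟩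
    rw [gco_succ, Real.cos_nat_mul_pi]
    have e : ((-1 : ℝ)) ^ k * (2 / (((k : ℝ) + 1) * (k + 2) * (k + 3))) * (-1) ^ (k + 1 + 1)
        = 2 / (((k : ℝ) + 1) * (k + 2) * (k + 3)) := by
      have : ((-1 : ℝ)) ^ k * (-1) ^ k = 1 := by rw [← mul_pow]; norm_num
      linear_combination (2 / (((k : ℝ) + 1) * (k + 2) * (k + 3))) * this
    rw [e]
    push_cast
    field_simp
    ring

lemma point_bound (u : ℝ) (hu : 0 < u) (m : ℕ) (hm : 1 ≤ m) (x : ℝ) (hx : x ∈ Set.Icc 0 u) :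
    |x * Real.log (1 / x) - -chebApprox u m x| ≤ u / (2 * m ^ 2) := by
  have hm' : (0 : ℝ) < m := by exact_mod_cast hm
  have hfin : u / 2 * (1 / ((m : ℝ) * (m + 1))) ≤ u / (2 * m ^ 2) := by
    have : u / (2 * (m : ℝ) ^ 2) = u / 2 * (1 / ((m : ℝ) * m)) := by field_simp
    rw [this]
    gcongr
    linarith
  refine le_trans ?_ hfin
  rcases hx.1.eq_or_lt with h0 | h0
  · subst h0
    rw [chebApprox_eq u 0 m hm Real.pi (by simp), zero_sum m hm]
    simp only [Real.cos_pi, zero_mul, zero_sub, neg_neg]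
    rw [show u / 2 * (Real.log (u / 4) * (1 + -1) + -(1 / ((m : ℝ) * (m + 1)))) =
      -(u / 2 * (1 / ((m : ℝ) * (m + 1)))) by ring, abs_neg, abs_of_nonneg (by positivity)]
  · have h1 : 2 / u * x ≤ 2 := by
      rw [div_mul_eq_mul_div, div_le_iff₀ hu]; linarith [hx.2]
    have h2 : 0 < 2 / u * x := by positivity
    have hc := Real.cos_arccos (x := 2 / u * x - 1) (by linarith) (by linarith)
    set θ := Real.arccos (2 / u * x - 1)
    rw [chebApprox_eq u x m hm θ hc.symm]
    have hpos : 0 < 1 + Real.cos θ := by linarith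
    have hb := cos_bound θ hpos m hm
    have hxe : x = u / 2 * (1 + Real.cos θ) := by
      rw [hc]; field_simp; ring
    have hl : Real.log x = Real.log (u / 4) + Real.log (2 + 2 * Real.cos θ) := by
      rw [← Real.log_mul (by positivity) (by linarith)]
      congr 1
      linarith
    rw [one_div, Real.log_inv, hl]
    set S := 1 + ∑ w ∈ Finset.range m, gco w * Real.cos ((w + 1 : ℕ) * θ)
    have e : x * -(Real.log (u / 4) + Real.log (2 + 2 * Real.cos θ)) -
        -(u / 2 * (Real.log (u / 4) * (1 + Real.cos θ) + S)) =
        -(u / 2 * ((1 + Real.cos θ) * Real.log (2 + 2 * Real.cos θ) - S)) := by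
      nth_rewrite 1 [hxe]; ring
    rw [e, abs_neg, abs_mul, abs_of_pos (by positivity : 0 < u / 2)]
    gcongr

/-- Additive error of the Chebyshev approximation to the entropy (eqn. (12) of the
paper): for `p_1, …, p_n ∈ [0, u]`,
`|∑ p_i ln(1/p_i) − ∑ (−f_m(p_i))| ≤ n·u/(2m²)` (with `0·ln(1/0) = 0`). -/
theorem chebApprox_entropy_additive_bound (u : ℝ) (hu : 0 < u) (m : ℕ) (hm : 1 ≤ m)
    (n : ℕ) (p : Fin n → ℝ) (hp : ∀ i, p i ∈ Set.Icc 0 u) :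
    |∑ i, p i * Real.log (1 / p i) - ∑ i, -chebApprox u m (p i)| ≤
      n * u / (2 * m ^ 2) := by
  rw [← Finset.sum_sub_distrib]
  refine (Finset.abs_sum_le_sum_abs _ _).trans ?_
  refine (Finset.sum_le_sum fun i _ => point_bound u hu m hm (p i) (hp i)).trans ?_
  simp [mul_div_assoc]
end

section
/- Let n ≥ 2, 0 < ℓ, 0 < u ≤ 1, ε ∈ (0, 1], and let p_1, …, p_n satisfy ℓ ≤ p_i ≤ u for all i and Σ_{i=1}^n p_i = 1. If the integer m satisfies m ≥ √( u / (2·ε·ℓ·ln(1/(1−ℓ))) ), then | Σ_{i=1}^n p_i ln(1/p_i) − Σ_{i=1}^n (−f_m(p_i)) | ≤ ε · Σ_{i=1}^n p_i ln(1/p_i). -/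
open Polynomial

lemma cheb_aux_step (z : ℂ) (n : ℕ) :
    (-1 : ℂ) ^ (n + 3 + 1) * z ^ (n + 3) / ((n + 3 : ℕ) : ℂ)
      + 2 * z * ((-1 : ℂ) ^ (n + 2 + 1) * z ^ (n + 2) / ((n + 2 : ℕ) : ℂ))
      + z ^ 2 * ((-1 : ℂ) ^ (n + 1 + 1) * z ^ (n + 1) / ((n + 1 : ℕ) : ℂ))
      = (-1 : ℂ) ^ n * z ^ (n + 3) * (2 / (((n : ℂ) + 1) * (n + 2) * (n + 3))) := by
  have h1 : (n : ℂ) + 1 ≠ 0 := by exact_mod_cast Nat.succ_ne_zero n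
  have h2 : (n : ℂ) + 2 ≠ 0 := by exact_mod_cast Nat.succ_ne_zero (n + 1)
  have h3 : (n : ℂ) + 3 ≠ 0 := by exact_mod_cast Nat.succ_ne_zero (n + 2)
  push_cast
  field_simp
  ring

lemma cheb_aux_hasSum (z : ℂ) (hz : ‖z‖ < 1) :
    HasSum (fun n : ℕ => (-1 : ℂ) ^ n * z ^ (n + 3) * (2 / (((n : ℂ) + 1) * (n + 2) * (n + 3))))
      ((1 + z) ^ 2 * Complex.log (1 + z) - z - 3 / 2 * z ^ 2) := by
  have h := Complex.hasSum_taylorSeries_log hz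
  have h1 := (hasSum_nat_add_iff' 1).2 h
  have h2 := (hasSum_nat_add_iff' 2).2 h
  have h3 := (hasSum_nat_add_iff' 3).2 h
  have H := (h3.add (h2.mul_left (2 * z))).add (h1.mul_left (z ^ 2))
  simp only [cheb_aux_step] at H
  have e : (1 + z) ^ 2 * Complex.log (1 + z) - z - 3 / 2 * z ^ 2 =
    Complex.log (1 + z) - ∑ i ∈ Finset.range 3, (-1) ^ (i + 1) * z ^ i / (i : ℂ) +
        2 * z * (Complex.log (1 + z) - ∑ i ∈ Finset.range 2, (-1) ^ (i + 1) * z ^ i / (i : ℂ)) +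
      z ^ 2 * (Complex.log (1 + z) - ∑ i ∈ Finset.range 1, (-1) ^ (i + 1) * z ^ i / (i : ℂ)) := by
    simp [Finset.sum_range_succ]
    ring
  rw [e]
  exact H

lemma cheb_aux_bound (z : ℂ) (hz : ‖z‖ < 1) (j : ℕ) :
    ‖(1 + z) ^ 2 * Complex.log (1 + z) - z - 3 / 2 * z ^ 2
      - ∑ n ∈ Finset.range j,
        (-1 : ℂ) ^ n * z ^ (n + 3) * (2 / (((n : ℂ) + 1) * (n + 2) * (n + 3)))‖
      ≤ 1 / (((j : ℝ) + 1) * (j + 2)) := by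
  have h := (cheb_aux_hasSum z hz).tendsto_sum_nat
  have h' := (h.sub_const (∑ n ∈ Finset.range j,
        (-1 : ℂ) ^ n * z ^ (n + 3) * (2 / (((n : ℂ) + 1) * (n + 2) * (n + 3))))).norm
  refine le_of_tendsto h' ?_
  filter_upwards [Filter.eventually_ge_atTop j] with N hN
  have key : ‖∑ n ∈ Finset.range N,
        (-1 : ℂ) ^ n * z ^ (n + 3) * (2 / (((n : ℂ) + 1) * (n + 2) * (n + 3)))
        - ∑ n ∈ Finset.range j,
        (-1 : ℂ) ^ n * z ^ (n + 3) * (2 / (((n : ℂ) + 1) * (n + 2) * (n + 3)))‖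
        ≤ 1 / (((j : ℝ) + 1) * (j + 2)) - 1 / (((N : ℝ) + 1) * (N + 2)) := by
    induction N, hN using Nat.le_induction with
    | base => simp
    | succ N hN ih =>
      rw [Finset.sum_range_succ, add_sub_right_comm]
      refine (norm_add_le _ _).trans ?_
      have ht : ‖(-1 : ℂ) ^ N * z ^ (N + 3) * (2 / (((N : ℂ) + 1) * (N + 2) * (N + 3)))‖
          ≤ 2 / (((N : ℝ) + 1) * (N + 2) * (N + 3)) := by
        have e : ((2 : ℂ) / (((N : ℂ) + 1) * (N + 2) * (N + 3)))
            = ((2 / (((N : ℝ) + 1) * (N + 2) * (N + 3)) : ℝ) : ℂ) := by push_cast; rfl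
        rw [e, norm_mul, norm_mul, norm_pow, norm_pow, norm_neg, norm_one, one_pow, one_mul,
          Complex.norm_real, Real.norm_of_nonneg (by positivity)]
        exact mul_le_of_le_one_left (by positivity) (pow_le_one₀ (norm_nonneg _) hz.le)
      have e2 : 2 / (((N : ℝ) + 1) * (N + 2) * (N + 3)) = 1 / (((N : ℝ) + 1) * (N + 2))
          - 1 / ((((N + 1 : ℕ) : ℝ) + 1) * ((N + 1 : ℕ) + 2)) := by
        push_cast
        have h1 : (N : ℝ) + 1 ≠ 0 := by positivity
        have h2 : (N : ℝ) + 2 ≠ 0 := by positivity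
        have h3 : (N : ℝ) + 3 ≠ 0 := by positivity
        have h4 : (N : ℝ) + 1 + 1 ≠ 0 := by positivity
        have h5 : (N : ℝ) + 1 + 2 ≠ 0 := by positivity
        field_simp
        ring
      linarith
  have : 0 ≤ 1 / (((N : ℝ) + 1) * (N + 2)) := by positivity
  linarith

lemma cheb_aux_bound_circle (z : ℂ) (hz : ‖z‖ = 1) (hre : 0 < (1 + z).re) (j : ℕ) :
    ‖(1 + z) ^ 2 * Complex.log (1 + z) - z - 3 / 2 * z ^ 2
      - ∑ n ∈ Finset.range j,
        (-1 : ℂ) ^ n * z ^ (n + 3) * (2 / (((n : ℂ) + 1) * (n + 2) * (n + 3)))‖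
      ≤ 1 / (((j : ℝ) + 1) * (j + 2)) := by
  set G : ℂ → ℝ := fun z => ‖(1 + z) ^ 2 * Complex.log (1 + z) - z - 3 / 2 * z ^ 2
      - ∑ n ∈ Finset.range j,
        (-1 : ℂ) ^ n * z ^ (n + 3) * (2 / (((n : ℂ) + 1) * (n + 2) * (n + 3)))‖ with hG
  have hlog : ContinuousAt (fun z : ℂ => Complex.log (1 + z)) z :=
    ContinuousAt.clog (by fun_prop) (Or.inl hre)
  have hc : ContinuousAt G z := by
    refine ContinuousAt.norm ?_
    refine ContinuousAt.sub ?_ (by fun_prop)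
    refine ContinuousAt.sub (ContinuousAt.sub ?_ (by fun_prop)) (by fun_prop)
    exact ContinuousAt.mul (by fun_prop) hlog
  have hr : Filter.Tendsto (fun r : ℝ => (r : ℂ) * z) (nhdsWithin 1 (Set.Iio 1)) (nhds z) := by
    have : ContinuousAt (fun r : ℝ => (r : ℂ) * z) 1 := by fun_prop
    have h := this.tendsto
    simp only [Complex.ofReal_one, one_mul] at h
    exact h.mono_left nhdsWithin_le_nhds
  refine le_of_tendsto (hc.tendsto.comp hr) ?_
  filter_upwards [Ioo_mem_nhdsLT (show (0 : ℝ) < 1 by norm_num)] with r hr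
  refine cheb_aux_bound _ ?_ j
  rw [norm_mul, hz, mul_one, Complex.norm_real, Real.norm_of_nonneg hr.1.le]
  exact hr.2

lemma cheb_aux_real (θ : ℝ) (hθ : 0 < 1 + Real.cos θ) (j : ℕ) :
    |(1 + Real.cos θ) * Real.log (2 * (1 + Real.cos θ)) - 1 - 3 / 2 * Real.cos θ
      - ∑ n ∈ Finset.range j, (-1 : ℝ) ^ n * (2 / (((n : ℝ) + 1) * (n + 2) * (n + 3)))
        * Real.cos ((n + 2) * θ)| ≤ 1 / (((j : ℝ) + 1) * (j + 2)) := by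
  set z : ℂ := Complex.exp (θ * Complex.I) with hzdef
  have hz : ‖z‖ = 1 := Complex.norm_exp_ofReal_mul_I θ
  have hzre : z.re = Real.cos θ := Complex.exp_ofReal_mul_I_re θ
  have hzim : z.im = Real.sin θ := Complex.exp_ofReal_mul_I_im θ
  have hb := cheb_aux_bound_circle z hz (by simpa [hzre] using hθ) j
  set w : ℂ := Complex.exp (-(θ * Complex.I)) with hwdef
  have hw : ‖w‖ = 1 := by
    have := Complex.norm_exp_ofReal_mul_I (-θ)
    rw [hwdef]; convert this using 3; push_cast; ring
  have hwz : w * z = 1 := by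
    rw [hwdef, hzdef, ← Complex.exp_add]; simp
  have hpow : ∀ k : ℕ, z ^ k = Complex.exp (((k * θ : ℝ) : ℂ) * Complex.I) := by
    intro k
    rw [hzdef, ← Complex.exp_nat_mul]; push_cast; congr 1; ring
  have hwadd : w + z = ((2 * Real.cos θ : ℝ) : ℂ) := by
    have := Complex.two_cos (θ : ℂ)
    push_cast
    rw [this, hwdef, hzdef, add_comm, neg_mul]
  refine le_trans ?_ hb
  refine le_trans (le_of_eq ?_) (le_trans (Complex.abs_re_le_norm (w * ((1 + z) ^ 2 * Complex.log (1 + z) - z - 3 / 2 * z ^ 2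
      - ∑ n ∈ Finset.range j,
        (-1 : ℂ) ^ n * z ^ (n + 3) * (2 / (((n : ℂ) + 1) * (n + 2) * (n + 3)))))) ?_)
  swap
  · rw [norm_mul, hw, one_mul]
  congr 1
  have e1 : w * ((1 + z) ^ 2 * Complex.log (1 + z) - z - 3 / 2 * z ^ 2
      - ∑ n ∈ Finset.range j,
        (-1 : ℂ) ^ n * z ^ (n + 3) * (2 / (((n : ℂ) + 1) * (n + 2) * (n + 3))))
      = ((2 * (1 + Real.cos θ) : ℝ) : ℂ) * Complex.log (1 + z) - ((1 : ℝ) : ℂ) - ((3 / 2 : ℝ) : ℂ) * z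
        - ∑ n ∈ Finset.range j, (((-1 : ℝ) ^ n * (2 / (((n : ℝ) + 1) * (n + 2) * (n + 3))) : ℝ) : ℂ)
          * z ^ (n + 2) := by
    rw [mul_sub, Finset.mul_sum]
    congr 1
    · have : ((2 * (1 + Real.cos θ) : ℝ) : ℂ) = 2 + (w + z) := by
        rw [hwadd]; push_cast; ring
      rw [this]
      push_cast
      linear_combination (2 * Complex.log (1 + z) + z * Complex.log (1 + z) - 1 - 3 / 2 * z) * hwz
    · refine Finset.sum_congr rfl fun n _ => ?_
      push_cast
      linear_combination ((-1 : ℂ) ^ n * z ^ (n + 2) * (2 / (((n : ℂ) + 1) * (n + 2) * (n + 3)))) * hwz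
  rw [e1]
  have hn : Real.log ‖1 + z‖ = 1 / 2 * Real.log (2 * (1 + Real.cos θ)) := by
    have : ‖1 + z‖ ^ 2 = 2 * (1 + Real.cos θ) := by
      rw [Complex.sq_norm, Complex.normSq_apply]
      simp only [Complex.add_re, Complex.add_im, Complex.one_re, Complex.one_im, hzre, hzim]
      nlinarith [Real.sin_sq_add_cos_sq θ]
    rw [← this, Real.log_pow]; push_cast; ring
  rw [Complex.sub_re, Complex.sub_re, Complex.sub_re, Complex.re_ofReal_mul, Complex.ofReal_re,
    Complex.re_ofReal_mul, Complex.re_sum, Complex.log_re, hn, hzre]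
  congr 1
  · ring
  · refine Finset.sum_congr rfl fun n _ => ?_
    rw [Complex.re_ofReal_mul, hpow, Complex.exp_ofReal_mul_I_re]
    push_cast
    rfl

lemma cheb_aux_pointwise (u : ℝ) (hu : 0 < u) (m : ℕ) (hm : 1 ≤ m) (x : ℝ) (hx : 0 < x)
    (hxu : x ≤ u) :
    |x * Real.log x - chebApprox u m x| ≤ u / (2 * (m * (m + 1))) := by
  obtain ⟨j, rfl⟩ : ∃ j, m = j + 1 := ⟨m - 1, by omega⟩
  set c : ℝ := 2 / u * x - 1 with hc
  have hcx : x = u * (1 + c) / 2 := by rw [hc]; field_simp; ring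
  have hc0 : 0 < 1 + c := by rw [hc]; ring_nf; positivity
  have hc1 : c ≤ 1 := by
    by_contra! h
    nlinarith
  set θ := Real.arccos c with hθ
  have hcos : Real.cos θ = c := Real.cos_arccos (by linarith) hc1
  have hT : ∀ w : ℕ, (Polynomial.Chebyshev.T ℝ (w : ℤ)).eval c = Real.cos (w * θ) := by
    intro w
    rw [← hcos, Polynomial.Chebyshev.T_real_cos]; push_cast; rfl
  have hb := cheb_aux_real θ (by rw [hcos]; exact hc0) j
  rw [hcos] at hb
  have hf : chebApprox u (j + 1) x = u / 2 * (Real.log (u / 4) + 1)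
      + u / 4 * (2 * Real.log (u / 4) + 3) * c
      + u / 2 * ∑ n ∈ Finset.range j, (-1 : ℝ) ^ n * (2 / (((n : ℝ) + 1) * (n + 2) * (n + 3)))
        * Real.cos ((n + 2) * θ) := by
    unfold chebApprox
    rw [← hc, Finset.sum_range_succ', Finset.sum_range_succ', Finset.mul_sum]
    simp only [hT, chebCoef]
    have : ∀ n ∈ Finset.range j, (-1 : ℝ) ^ (n + 2) * u / (((n + 2 : ℕ) : ℝ) ^ 3 - ((n + 2 : ℕ) : ℝ))
        * Real.cos (((n + 1 + 1 : ℕ) : ℝ) * θ)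
        = u / 2 * ((-1 : ℝ) ^ n * (2 / (((n : ℝ) + 1) * (n + 2) * (n + 3)))
        * Real.cos ((n + 2) * θ)) := by
      intro n _
      have e : (((n + 2 : ℕ) : ℝ) ^ 3 - ((n + 2 : ℕ) : ℝ)) = ((n : ℝ) + 1) * (n + 2) * (n + 3) := by
        push_cast; ring
      have e' : (((n + 1 + 1 : ℕ) : ℝ)) = n + 2 := by push_cast; ring
      rw [e, e', pow_add]
      have : ((n : ℝ) + 1) * (n + 2) * (n + 3) ≠ 0 := by positivity
      field_simp
    rw [Finset.sum_congr rfl this]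
    simp [hcos]
    ring
  have hlog : Real.log x = Real.log (2 * (1 + c)) + Real.log (u / 4) := by
    rw [← Real.log_mul (by positivity) (by positivity)]
    congr 1; rw [hcx]; ring
  rw [hf, hlog]
  have e : x * (Real.log (2 * (1 + c)) + Real.log (u / 4)) - (u / 2 * (Real.log (u / 4) + 1)
      + u / 4 * (2 * Real.log (u / 4) + 3) * c
      + u / 2 * ∑ n ∈ Finset.range j, (-1 : ℝ) ^ n * (2 / (((n : ℝ) + 1) * (n + 2) * (n + 3)))
        * Real.cos ((n + 2) * θ)) = u / 2 * ((1 + c) * Real.log (2 * (1 + c)) - 1 - 3 / 2 * c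
      - ∑ n ∈ Finset.range j, (-1 : ℝ) ^ n * (2 / (((n : ℝ) + 1) * (n + 2) * (n + 3)))
        * Real.cos ((n + 2) * θ)) := by
    conv_lhs => rw [show x * (Real.log (2 * (1 + c)) + Real.log (u / 4)) =
      (u * (1 + c) / 2) * (Real.log (2 * (1 + c)) + Real.log (u / 4)) by rw [← hcx]]
    ring
  rw [e, abs_mul, abs_of_pos (by positivity)]
  refine (mul_le_mul_of_nonneg_left hb (by positivity)).trans (le_of_eq ?_)
  push_cast
  have h1 : (j : ℝ) + 1 + 1 = j + 2 := by ring
  rw [h1]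
  field_simp

/-- Relative error of the Chebyshev approximation to the entropy (eqn. (14) of the
paper): if `m ≥ √(u/(2εℓ ln(1/(1−ℓ))))` then
`|∑ p_i ln(1/p_i) − ∑ (−f_m(p_i))| ≤ ε ∑ p_i ln(1/p_i)`. -/
theorem chebApprox_entropy_relative_bound (n : ℕ) (hn : 2 ≤ n) (ℓ u : ℝ)
    (hℓ : 0 < ℓ) (hu0 : 0 < u) (hu1 : u ≤ 1) (ε : ℝ) (hε : ε ∈ Set.Ioc (0 : ℝ) 1)
    (p : Fin n → ℝ) (hp : ∀ i, p i ∈ Set.Icc ℓ u) (hsum : ∑ i, p i = 1)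
    (m : ℕ) (hm : Real.sqrt (u / (2 * ε * ℓ * Real.log (1 / (1 - ℓ)))) ≤ m) :
    |∑ i, p i * Real.log (1 / p i) - ∑ i, -chebApprox u m (p i)| ≤
      ε * ∑ i, p i * Real.log (1 / p i) := by
  have hpos : ∀ i, 0 < p i := fun i => hℓ.trans_le (hp i).1
  have hple : ∀ i, p i ≤ 1 - ℓ := by
    intro i
    have : Nontrivial (Fin n) := Fin.nontrivial_iff_two_le.2 hn
    obtain ⟨k, hk⟩ := exists_ne i
    have h2 : ∑ a ∈ ({i, k} : Finset (Fin n)), p a ≤ ∑ a, p a :=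
      Finset.sum_le_sum_of_subset_of_nonneg (Finset.subset_univ _) fun a _ _ => (hpos a).le
    rw [Finset.sum_pair hk.symm, hsum] at h2
    linarith [(hp k).1]
  have hl1 : 0 < 1 - ℓ := (hpos ⟨0, by omega⟩).trans_le (hple _)
  set L := Real.log (1 / (1 - ℓ)) with hL
  have hLpos : 0 < L := Real.log_pos (by rw [lt_div_iff₀ hl1]; linarith)
  have hε0 := hε.1
  have hQ : 0 < u / (2 * ε * ℓ * L) := by positivity
  have hmpos : (0 : ℝ) < m := (Real.sqrt_pos.2 hQ).trans_le hm
  have hm1 : 1 ≤ m := by exact_mod_cast hmpos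
  have hsq : u / (2 * ε * ℓ * L) ≤ (m : ℝ) ^ 2 := (Real.sqrt_le_left hmpos.le).1 hm
  have herr : u / (2 * (m * ((m : ℝ) + 1))) ≤ ε * (ℓ * L) := by
    rw [div_le_iff₀ (by positivity)] at hsq ⊢
    have : 0 < ε * ℓ * L := by positivity
    nlinarith
  rw [← Finset.sum_sub_distrib, Finset.mul_sum]
  refine (Finset.abs_sum_le_sum_abs _ _).trans (Finset.sum_le_sum fun i _ => ?_)
  have hb := cheb_aux_pointwise u hu0 m hm1 (p i) (hpos i) (hp i).2
  have e : p i * Real.log (1 / p i) - -chebApprox u m (p i)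
      = -(p i * Real.log (p i) - chebApprox u m (p i)) := by
    rw [one_div, Real.log_inv]; ring
  rw [e, abs_neg]
  refine hb.trans (herr.trans (mul_le_mul_of_nonneg_left ?_ hε0.le))
  refine mul_le_mul (hp i).1 ?_ hLpos.le (hpos i).le
  exact Real.log_le_log (by positivity) (one_div_le_one_div_of_le (hpos i) (hple i))
end

section
/- (Deterministic core of Theorem 2.) Let n ≥ 2, 0 < ℓ, 0 < u ≤ 1, ε ∈ (0, 1], let p_1, …, p_n satisfy ℓ ≤ p_i ≤ u for all i and Σ_{i=1}^n p_i = 1, and let the integer m satisfy m ≥ √( u / (2·ε·ℓ·ln(1/(1−ℓ))) ). Write H = Σ_{i=1}^n p_i ln(1/p_i) and S = Σ_{i=1}^n (−f_m(p_i)). If T̃ ∈ ℝ satisfies | T̃ − S | ≤ ε·S, then | T̃ − H | ≤ 3ε·H. -/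
open Polynomial

lemma ce_coef_tel (k : ℕ) : (1:ℝ) / ((k+1)*(k+2)*(k+3)) =
    1/(2*(k+1)*(k+2)) - 1/(2*((k+1:ℕ)+1)*((k+1:ℕ)+2)) := by
  push_cast
  field_simp
  ring

lemma ce_sum_le (N M : ℕ) (h : N ≤ M) (c : ℕ → ℝ)
    (hc : ∀ k, |c k| ≤ 1 / (((k:ℝ)+1)*(k+2)*(k+3))) :
    |∑ k ∈ Finset.range M, c k - ∑ k ∈ Finset.range N, c k|
      ≤ 1/(2*((N:ℝ)+1)*(N+2)) - 1/(2*((M:ℝ)+1)*(M+2)) := by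
  induction M, h using Nat.le_induction with
  | base => simp
  | succ M h ih =>
    rw [Finset.sum_range_succ]
    have h1 := hc M
    rw [ce_coef_tel] at h1
    have h2 := abs_add_le (∑ k ∈ Finset.range M, c k - ∑ k ∈ Finset.range N, c k) (c M)
    rw [show ∑ k ∈ Finset.range M, c k + c M - ∑ k ∈ Finset.range N, c k =
      ∑ k ∈ Finset.range M, c k - ∑ k ∈ Finset.range N, c k + c M by ring]
    linarith

lemma ce_tail (N : ℕ) (c : ℕ → ℝ) (s : ℝ)
    (hc : ∀ k, |c k| ≤ 1 / (((k:ℝ)+1)*(k+2)*(k+3))) (hs : HasSum c s) :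
    |s - ∑ k ∈ Finset.range N, c k| ≤ 1/(2*((N:ℝ)+1)*(N+2)) := by
  have h := hs.tendsto_sum_nat
  have h2 := (h.sub_const (∑ k ∈ Finset.range N, c k)).abs
  refine le_of_tendsto h2 ?_
  filter_upwards [Filter.eventually_ge_atTop N] with M hM
  have := ce_sum_le N M hM c hc
  have h3 : 0 ≤ 1/(2*((M:ℝ)+1)*(M+2)) := by positivity
  linarith

lemma ce_summable : Summable (fun k : ℕ => 1 / (((k:ℝ)+1)*(k+2)*(k+3))) := by
  refine summable_of_sum_range_le (c := 1/4) (fun k => by positivity) (fun M => ?_)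
  have := ce_sum_le 0 M (Nat.zero_le _) (fun k : ℕ => 1 / (((k:ℝ)+1)*(k+2)*(k+3)))
    (fun k => by rw [abs_of_nonneg (by positivity)])
  have h3 : 0 ≤ 1/(2*((M:ℝ)+1)*(M+2)) := by positivity
  have h4 := le_abs_self (∑ k ∈ Finset.range M, 1 / (((k:ℝ)+1)*(k+2)*(k+3)))
  norm_num at this h3 h4 ⊢
  linarith

noncomputable def ceTerm (k : ℕ) (z : ℂ) : ℂ :=
  (-1)^k * z^(k+3) / (((k:ℂ)+1)*(k+2)*(k+3))

lemma ce_norm (k : ℕ) (z : ℂ) (hz : ‖z‖ ≤ 1) :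
    ‖ceTerm k z‖ ≤ 1 / (((k:ℝ)+1)*(k+2)*(k+3)) := by
  have e : ((((k:ℂ)+1)*(k+2)*(k+3))) = (((((k:ℝ)+1)*(k+2)*(k+3)) : ℝ) : ℂ) := by push_cast; ring
  unfold ceTerm
  rw [e, norm_div, Complex.norm_real, Real.norm_of_nonneg (by positivity), norm_mul, norm_pow,
    norm_pow, norm_neg, norm_one, one_pow, one_mul]
  gcongr
  exact pow_le_one₀ (norm_nonneg _) hz

noncomputable def ceLim (z : ℂ) : ℂ :=
  ((z+1)^2 * Complex.log (1+z) - 3*z^2/2 - z) / 2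

lemma ce_inside (z : ℂ) (hz : ‖z‖ < 1) : HasSum (fun k => ceTerm k z) (ceLim z) := by
  have h := Complex.hasSum_taylorSeries_log hz
  have h1 := ((hasSum_nat_add_iff' 1).mpr h).mul_left (z^2)
  have h2 := ((hasSum_nat_add_iff' 2).mpr h).mul_left (2*z)
  have h3 := ((hasSum_nat_add_iff' 3).mpr h)
  have h4 := ((h1.add h2).add h3).mul_left (1/2)
  have e1 : (fun k => ceTerm k z) = (fun k : ℕ => 1 / 2 *
        (z ^ 2 * ((-1) ^ (k + 1 + 1) * z ^ (k + 1) / ((k + 1 : ℕ) : ℂ)) +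
          2 * z * ((-1) ^ (k + 2 + 1) * z ^ (k + 2) / ((k + 2 : ℕ) : ℂ)) +
          (-1) ^ (k + 3 + 1) * z ^ (k + 3) / ((k + 3 : ℕ) : ℂ))) := by
    funext k
    unfold ceTerm
    have a1 : (k:ℂ)+1 ≠ 0 := by exact_mod_cast Nat.succ_ne_zero k
    have a2 : (k:ℂ)+2 ≠ 0 := by exact_mod_cast Nat.succ_ne_zero (k+1)
    have a3 : (k:ℂ)+3 ≠ 0 := by exact_mod_cast Nat.succ_ne_zero (k+2)
    push_cast
    field_simp
    ring
  have e2 : ceLim z = 1 / 2 *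
      (z ^ 2 * (Complex.log (1 + z) - ∑ i ∈ Finset.range 1, (-1) ^ (i + 1) * z ^ i / (i : ℂ)) +
          2 * z * (Complex.log (1 + z) - ∑ i ∈ Finset.range 2, (-1) ^ (i + 1) * z ^ i / (i : ℂ)) +
        (Complex.log (1 + z) - ∑ i ∈ Finset.range 3, (-1) ^ (i + 1) * z ^ i / (i : ℂ))) := by
    simp [Finset.sum_range_succ, ceLim]
    ring
  rw [e1, e2]
  exact h4

lemma ce_boundary (z : ℂ) (hz : ‖z‖ = 1) (hre : -1 < z.re) :
    HasSum (fun k => ceTerm k z) (ceLim z) := by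
  have hsumm : Summable (fun k => ceTerm k z) :=
    Summable.of_norm_bounded ce_summable (fun k => ce_norm k z hz.le)
  have hcont : ContinuousOn (fun r : ℝ => ∑' k, ceTerm k (r * z)) (Set.Icc 0 1) := by
    refine continuousOn_tsum (fun k => ?_) ce_summable (fun k r hr => ?_)
    · unfold ceTerm; fun_prop
    · apply ce_norm
      rw [norm_mul, hz, mul_one, Complex.norm_real, Real.norm_of_nonneg hr.1]
      exact hr.2
  have h1 : Filter.Tendsto (fun r : ℝ => ∑' k, ceTerm k (r * z)) (nhdsWithin 1 (Set.Ico 0 1))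
      (nhds (∑' k, ceTerm k z)) := by
    have := (hcont 1 (by simp)).mono_left (nhdsWithin_mono _ Set.Ico_subset_Icc_self)
    simpa using this
  have h2 : Filter.Tendsto (fun r : ℝ => ceLim (r * z)) (nhdsWithin 1 (Set.Ico 0 1))
      (nhds (ceLim z)) := by
    have : ContinuousAt (fun r : ℝ => ceLim (r * z)) 1 := by
      unfold ceLim
      have hs : 1 + ((1:ℝ):ℂ) * z ∈ Complex.slitPlane := by
        left; simp; linarith
      have hl : ContinuousAt (fun r : ℝ => Complex.log (1 + (r:ℂ) * z)) 1 :=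
        ContinuousAt.clog (by fun_prop) hs
      fun_prop
    have := this.tendsto.mono_left (nhdsWithin_le_nhds (s := Set.Ico 0 1))
    simpa using this
  have h3 : Filter.Tendsto (fun r : ℝ => ∑' k, ceTerm k (r * z)) (nhdsWithin 1 (Set.Ico 0 1))
      (nhds (ceLim z)) := by
    refine h2.congr' ?_
    filter_upwards [self_mem_nhdsWithin] with r hr
    refine (ce_inside _ ?_).tsum_eq.symm
    rw [norm_mul, hz, mul_one, Complex.norm_real, Real.norm_of_nonneg hr.1]
    exact hr.2
  have : (nhdsWithin (1:ℝ) (Set.Ico 0 1)).NeBot := by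
    rw [← mem_closure_iff_nhdsWithin_neBot, closure_Ico (by norm_num)]
    simp
  rw [← tendsto_nhds_unique h1 h3]
  exact hsumm.hasSum

lemma ce_cos (θ : ℝ) (h : -1 < Real.cos θ) :
    HasSum (fun k : ℕ => (-1)^k * Real.cos ((k+2:ℕ)*θ) / (((k:ℝ)+1)*(k+2)*(k+3)))
      (1/2*(1+Real.cos θ) * Real.log (2+2*Real.cos θ) - 1/2 - 3/4*Real.cos θ) := by
  set z := Complex.exp (θ * Complex.I) with hzdef
  have hz : ‖z‖ = 1 := Complex.norm_exp_ofReal_mul_I θ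
  have hre : z.re = Real.cos θ := Complex.exp_ofReal_mul_I_re θ
  have him : z.im = Real.sin θ := Complex.exp_ofReal_mul_I_im θ
  have hz0 : z ≠ 0 := Complex.exp_ne_zero _
  have hb := (ce_boundary z hz (by rw [hre]; exact h)).mul_left z⁻¹
  have hb2 := Complex.hasSum_re hb
  convert hb2 using 1
  · funext k
    have e : z⁻¹ * ceTerm k z =
      (((-1)^k / (((k:ℝ)+1)*(k+2)*(k+3)) : ℝ) : ℂ) * Complex.exp ((((k+2:ℕ)*θ : ℝ) : ℂ) * Complex.I) := by
      have : Complex.exp ((((k+2:ℕ)*θ : ℝ) : ℂ) * Complex.I) = z^(k+2) := by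
        rw [hzdef, ← Complex.exp_nat_mul]; congr 1; push_cast; ring
      rw [this]
      unfold ceTerm
      push_cast
      rw [pow_succ z (k+2)]
      field_simp
    rw [e, Complex.re_ofReal_mul, Complex.exp_ofReal_mul_I_re]
    ring
  · have hinv : z + 2 + z⁻¹ = ((2 + 2 * Real.cos θ : ℝ) : ℂ) := by
      have : z⁻¹ = Complex.exp (-(θ:ℂ) * Complex.I) := by
        rw [hzdef, ← Complex.exp_neg]; congr 1; ring
      rw [this]
      push_cast
      rw [Complex.cos]
      ring
    have e : z⁻¹ * ceLim z = ((1/2 : ℝ):ℂ) * (((2 + 2 * Real.cos θ : ℝ) : ℂ) * Complex.log (1+z)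
        - ((3/2:ℝ):ℂ)*z - 1) := by
      rw [← hinv]; unfold ceLim; push_cast; field_simp; ring
    rw [e, Complex.re_ofReal_mul, Complex.sub_re, Complex.sub_re, Complex.re_ofReal_mul,
      Complex.re_ofReal_mul, Complex.log_re, hre, Complex.one_re]
    have hn : Real.log (2+2*Real.cos θ) = 2 * Real.log ‖1+z‖ := by
      have : 2+2*Real.cos θ = ‖1+z‖^2 := by
        rw [← Complex.normSq_eq_norm_sq, Complex.normSq_apply]
        simp only [Complex.add_re, Complex.add_im, Complex.one_re, Complex.one_im, hre, him]
        nlinarith [Real.sin_sq_add_cos_sq θ]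
      rw [this, Real.log_pow]; push_cast; ring
    rw [hn]
    ring

lemma ce_approx (u : ℝ) (hu : 0 < u) (x : ℝ) (hx : 0 < x) (hxu : x ≤ u) (N : ℕ) :
    |x * Real.log x - chebApprox u (N+1) x| ≤ u * (1/(2*((N:ℝ)+1)*(N+2))) := by
  have hxu' : x / u ≤ 1 := (div_le_one hu).mpr hxu
  have hxp : 0 < x / u := by positivity
  set θ := Real.arccos (2/u*x-1) with hθ
  have hcos : Real.cos θ = 2/u*x-1 := by
    have : 2/u*x = 2*(x/u) := by ring
    apply Real.cos_arccos <;> linarith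
  have hgt : -1 < Real.cos θ := by
    have : 2/u*x = 2*(x/u) := by ring
    linarith
  have hs := ce_cos θ hgt
  have ht := ce_tail N _ _ (fun k => by
    rw [abs_div, abs_mul, abs_pow, abs_neg, abs_one, one_pow, one_mul,
      abs_of_pos (show 0 < ((k:ℝ)+1)*(k+2)*(k+3) by positivity)]
    gcongr
    exact Real.abs_cos_le_one _) hs
  have hx2 : x = u/4*(2+2*Real.cos θ) := by rw [hcos]; field_simp; ring
  have hlog : Real.log x = Real.log (u/4) + Real.log (2+2*Real.cos θ) := by
    conv_lhs => rw [hx2]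
    rw [Real.log_mul (by positivity) (by linarith)]
  have hf : chebApprox u (N+1) x = u/2*(Real.log (u/4)+1) + u/4*(2*Real.log (u/4)+3)*Real.cos θ
     + u * ∑ k ∈ Finset.range N, (-1)^k * Real.cos ((k+2:ℕ)*θ) / (((k:ℝ)+1)*(k+2)*(k+3)) := by
    unfold chebApprox
    rw [Finset.sum_range_succ', Finset.sum_range_succ', ← hcos, Finset.mul_sum]
    have : ∀ k : ℕ, chebCoef u (k+1+1) * (Polynomial.Chebyshev.T ℝ ((k+1+1:ℕ) : ℤ)).eval (Real.cos θ)
       = u * ((-1)^k * Real.cos ((k+2:ℕ)*θ) / (((k:ℝ)+1)*(k+2)*(k+3))) := by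
      intro k
      rw [Polynomial.Chebyshev.T_real_cos]
      simp only [chebCoef]
      have : (((k + 2 : ℕ) : ℝ) ^ 3 - ((k + 2 : ℕ) : ℝ)) = ((k:ℝ)+1)*(k+2)*(k+3) := by
        push_cast; ring
      rw [this]
      push_cast
      ring_nf
    rw [Finset.sum_congr rfl (fun k _ => this k)]
    simp [chebCoef]
    ring
  have key : x * Real.log x - chebApprox u (N+1) x = u *
     ((1/2*(1+Real.cos θ) * Real.log (2+2*Real.cos θ) - 1/2 - 3/4*Real.cos θ) -
      ∑ k ∈ Finset.range N, (-1)^k * Real.cos ((k+2:ℕ)*θ) / (((k:ℝ)+1)*(k+2)*(k+3))) := by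
    rw [hf, hlog]
    conv_lhs => rw [hx2]
    ring
  rw [key, abs_mul, abs_of_pos hu]
  gcongr


/-- Deterministic core of Theorem 2: with `H = ∑ p_i ln(1/p_i)`,
`S = ∑ (−f_m(p_i))`, and `m ≥ √(u/(2εℓ ln(1/(1−ℓ))))`, if `|T̃ − S| ≤ ε·S`
then `|T̃ − H| ≤ 3ε·H`. -/
theorem cheb_entropy_estimate_bound (n : ℕ) (hn : 2 ≤ n) (ℓ u : ℝ)
    (hℓ : 0 < ℓ) (hu0 : 0 < u) (hu1 : u ≤ 1) (ε : ℝ) (hε : ε ∈ Set.Ioc (0 : ℝ) 1)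
    (p : Fin n → ℝ) (hp : ∀ i, p i ∈ Set.Icc ℓ u) (hsum : ∑ i, p i = 1)
    (m : ℕ) (hm : Real.sqrt (u / (2 * ε * ℓ * Real.log (1 / (1 - ℓ)))) ≤ m)
    (Ttil : ℝ)
    (hTtil : |Ttil - ∑ i, -chebApprox u m (p i)| ≤ ε * ∑ i, -chebApprox u m (p i)) :
    |Ttil - ∑ i, p i * Real.log (1 / p i)| ≤
      3 * ε * ∑ i, p i * Real.log (1 / p i) := by
  obtain ⟨hε0, hε1⟩ := hε
  have hle : ∀ i, p i ≤ 1 - ℓ := by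
    intro i
    have : Nontrivial (Fin n) := Fin.nontrivial_iff_two_le.mpr hn
    obtain ⟨j, hj⟩ := exists_ne i
    have h1 : ∑ k ∈ ({i, j} : Finset (Fin n)), p k ≤ ∑ k, p k :=
      Finset.sum_le_sum_of_subset_of_nonneg (Finset.subset_univ _)
        (fun k _ _ => hℓ.le.trans (hp k).1)
    rw [Finset.sum_pair hj.symm, hsum] at h1
    linarith [(hp j).1]
  have hpos : ∀ i, 0 < p i := fun i => hℓ.trans_le (hp i).1
  have h1ℓ : 0 < 1 - ℓ := (hpos ⟨0, by omega⟩).trans_le (hle ⟨0, by omega⟩)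
  have hL : 0 < Real.log (1 / (1 - ℓ)) := by
    apply Real.log_pos
    rw [lt_div_iff₀ h1ℓ]; linarith
  set L := Real.log (1 / (1 - ℓ)) with hLdef
  have hterm : ∀ i, ℓ * L ≤ p i * Real.log (1 / p i) := by
    intro i
    have : L ≤ Real.log (1 / p i) := by
      apply Real.log_le_log (by positivity)
      exact one_div_le_one_div_of_le (hpos i) (hle i)
    exact mul_le_mul (hp i).1 this hL.le (hpos i).le
  have hm0 : 0 < (m : ℝ) := lt_of_lt_of_le (Real.sqrt_pos.mpr (by positivity)) hm
  have hm2 : u / (2 * ε * ℓ * L) ≤ (m:ℝ)^2 := (Real.sqrt_le_left hm0.le).mp hm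
  obtain ⟨N, rfl⟩ : ∃ N, m = N + 1 := Nat.exists_eq_succ_of_ne_zero (by
    rintro rfl; simp at hm0)
  have hb : u * (1/(2*((N:ℝ)+1)*(N+2))) ≤ ε * (ℓ * L) := by
    rw [div_le_iff₀ (by positivity)] at hm2
    rw [mul_one_div, div_le_iff₀ (by positivity)]
    push_cast at hm2
    have : 0 < ε * (ℓ * L) := by positivity
    have hN : (0:ℝ) ≤ N := Nat.cast_nonneg N
    nlinarith [mul_nonneg this.le hN]
  have hpt : ∀ i, |(-chebApprox u (N+1) (p i)) - p i * Real.log (1 / p i)| ≤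
      ε * (p i * Real.log (1 / p i)) := by
    intro i
    have h1 := ce_approx u hu0 (p i) (hpos i) (hp i).2 N
    have h2 : (-chebApprox u (N+1) (p i)) - p i * Real.log (1 / p i) =
      p i * Real.log (p i) - chebApprox u (N+1) (p i) := by
      rw [one_div, Real.log_inv]; ring
    rw [h2]
    exact h1.trans (hb.trans (mul_le_mul_of_nonneg_left (hterm i) hε0.le))
  have hSH : |∑ i, -chebApprox u (N+1) (p i) - ∑ i, p i * Real.log (1 / p i)| ≤
      ε * ∑ i, p i * Real.log (1 / p i) := by
    rw [← Finset.sum_sub_distrib, Finset.mul_sum]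
    exact (Finset.abs_sum_le_sum_abs _ _).trans (Finset.sum_le_sum (fun i _ => hpt i))
  have hH : 0 ≤ ∑ i, p i * Real.log (1 / p i) :=
    Finset.sum_nonneg (fun i _ => (by positivity : 0 ≤ ℓ * L).trans (hterm i))
  generalize ∑ i, -chebApprox u (N+1) (p i) = S at *
  generalize ∑ i, p i * Real.log (1 / p i) = H at *
  have h3 : |Ttil - H| ≤ |Ttil - S| + |S - H| := abs_sub_le _ _ _
  have h4 : S ≤ H + ε * H := by linarith [(abs_le.mp hSH).2]
  have h5 : ε * S ≤ ε * (H + ε * H) := mul_le_mul_of_nonneg_left h4 hε0.le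
  have h6 : ε * (ε * H) ≤ ε * H := by
    have : ε * H ≤ H := by nlinarith
    exact mul_le_mul_of_nonneg_left this hε0.le
  linarith
end

section
/- Let ε ∈ (0, 1/2), let p_1, …, p_k ∈ (0, 1) with Σ_{i=1}^k p_i = 1, and let p̃_1, …, p̃_k ∈ (0, 1] satisfy √(1−ε)·p_i ≤ p̃_i ≤ √(1+ε)·p_i for all i. Write H = Σ_{i=1}^k p_i ln(1/p_i). Then Σ_{i=1}^k p̃_i ln(1/p̃_i) ≤ (1 + √ε)·H + √(3/2)·ε. -/
/-- Upper bound on the entropy computed from approximate probabilities: if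
`√(1−ε)·p_i ≤ p̃_i ≤ √(1+ε)·p_i` for all `i`, with `∑ p_i = 1` and `ε ∈ (0, 1/2)`,
then `∑ p̃_i ln(1/p̃_i) ≤ (1 + √ε)·H + √(3/2)·ε` where `H = ∑ p_i ln(1/p_i)`. -/
theorem approx_entropy_upper_bound (ε : ℝ) (hε : ε ∈ Set.Ioo (0 : ℝ) (1 / 2))
    (k : ℕ) (p q : Fin k → ℝ)
    (hp : ∀ i, p i ∈ Set.Ioo (0 : ℝ) 1) (hsum : ∑ i, p i = 1)
    (hq : ∀ i, q i ∈ Set.Ioc (0 : ℝ) 1)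
    (happrox : ∀ i, Real.sqrt (1 - ε) * p i ≤ q i ∧ q i ≤ Real.sqrt (1 + ε) * p i) :
    ∑ i, q i * Real.log (1 / q i) ≤
      (1 + Real.sqrt ε) * ∑ i, p i * Real.log (1 / p i) +
        Real.sqrt (3 / 2) * ε := by
  obtain ⟨h0, h1⟩ := hε
  have hs0 : 0 ≤ Real.sqrt ε := Real.sqrt_nonneg _
  have hup : Real.sqrt (1 + ε) ≤ 1 + Real.sqrt ε := by
    rw [Real.sqrt_le_left (by linarith)]
    nlinarith [Real.sq_sqrt h0.le]
  have hlo : 1 - ε ≤ Real.sqrt (1 - ε) := by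
    apply Real.le_sqrt_of_sq_le
    nlinarith
  have h32 : 1 ≤ Real.sqrt (3 / 2) := by
    apply Real.le_sqrt_of_sq_le
    norm_num
  have key : ∀ i, q i * Real.log (1 / q i) ≤
      (1 + Real.sqrt ε) * (p i * Real.log (1 / p i)) + Real.sqrt (3 / 2) * ε * p i := by
    intro i
    obtain ⟨hp0, hp1⟩ := hp i
    obtain ⟨hq0, hq1⟩ := hq i
    obtain ⟨ha, hb⟩ := happrox i
    have e1 : Real.log (1 / q i) = Real.log (1 / p i) + Real.log (p i / q i) := by
      rw [← Real.log_mul (by positivity) (by positivity)]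
      congr 1
      field_simp
    have hL : 0 ≤ Real.log (1 / p i) := by
      apply Real.log_nonneg
      rw [le_div_iff₀ hp0]
      linarith
    have e2 : Real.log (p i / q i) ≤ p i / q i - 1 :=
      Real.log_le_sub_one_of_pos (by positivity)
    have e3 : q i * Real.log (p i / q i) ≤ p i - q i := by
      calc q i * Real.log (p i / q i) ≤ q i * (p i / q i - 1) :=
            mul_le_mul_of_nonneg_left e2 hq0.le
        _ = p i - q i := by field_simp
    have e4 : (1 - ε) * p i ≤ q i := (mul_le_mul_of_nonneg_right hlo hp0.le).trans ha
    have e5 : q i ≤ (1 + Real.sqrt ε) * p i :=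
      hb.trans (mul_le_mul_of_nonneg_right hup hp0.le)
    have e6 := mul_le_mul_of_nonneg_right e5 hL
    have e7 : 1 * (ε * p i) ≤ Real.sqrt (3 / 2) * (ε * p i) :=
      mul_le_mul_of_nonneg_right h32 (by positivity)
    rw [e1]
    linarith
  calc ∑ i, q i * Real.log (1 / q i)
      ≤ ∑ i, ((1 + Real.sqrt ε) * (p i * Real.log (1 / p i)) + Real.sqrt (3 / 2) * ε * p i) :=
        Finset.sum_le_sum fun i _ => key i
    _ = _ := by
        rw [Finset.sum_add_distrib, ← Finset.mul_sum, ← Finset.mul_sum, hsum, mul_one]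
end

section
/- Let ε ∈ (0, 1/2), let p_1, …, p_k ∈ (0, 1) with Σ_{i=1}^k p_i = 1, and let p̃_1, …, p̃_k ∈ (0, 1] satisfy √(1−ε)·p_i ≤ p̃_i ≤ √(1+ε)·p_i for all i. Write H = Σ_{i=1}^k p_i ln(1/p_i). Then Σ_{i=1}^k p̃_i ln(1/p̃_i) ≥ (1 − √ε)·H − ε/2. -/
theorem mul_log_le_aux (ε r : ℝ) (hε : 0 < ε) (hr : 0 < r) (h : r ^ 2 ≤ 1 + ε) :
    r * Real.log r ≤ ε / 2 := by
  rcases le_total r 1 with h1 | h1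
  · have := mul_nonpos_of_nonneg_of_nonpos hr.le (Real.log_nonpos hr.le h1)
    linarith
  · have h2 := Real.self_le_sinh_iff.mpr (Real.log_nonneg h1)
    rw [Real.sinh_eq, Real.exp_neg, Real.exp_log hr] at h2
    have h3 := mul_le_mul_of_nonneg_left h2 hr.le
    have h4 : r * ((r - r⁻¹) / 2) = (r ^ 2 - 1) / 2 := by
      field_simp
    linarith

/-- Lower bound on the entropy computed from approximate probabilities: if
`√(1−ε)·p_i ≤ p̃_i ≤ √(1+ε)·p_i` for all `i`, with `∑ p_i = 1` and `ε ∈ (0, 1/2)`,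
then `∑ p̃_i ln(1/p̃_i) ≥ (1 − √ε)·H − ε/2` where `H = ∑ p_i ln(1/p_i)`. -/
theorem approx_entropy_lower_bound (ε : ℝ) (hε : ε ∈ Set.Ioo (0 : ℝ) (1 / 2))
    (k : ℕ) (p q : Fin k → ℝ)
    (hp : ∀ i, p i ∈ Set.Ioo (0 : ℝ) 1) (hsum : ∑ i, p i = 1)
    (hq : ∀ i, q i ∈ Set.Ioc (0 : ℝ) 1)
    (happrox : ∀ i, Real.sqrt (1 - ε) * p i ≤ q i ∧ q i ≤ Real.sqrt (1 + ε) * p i) :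
    (1 - Real.sqrt ε) * ∑ i, p i * Real.log (1 / p i) - ε / 2 ≤
      ∑ i, q i * Real.log (1 / q i) := by
  obtain ⟨h0, h1⟩ := hε
  have hs0 := Real.sqrt_nonneg ε
  have hs2 := Real.sq_sqrt h0.le
  have hs1 : Real.sqrt ε ≤ 1 := by
    rw [Real.sqrt_le_one]
    linarith
  have hlow : 1 - Real.sqrt ε ≤ Real.sqrt (1 - ε) := by
    apply Real.le_sqrt_of_sq_le
    nlinarith
  have key : ∀ i, (1 - Real.sqrt ε) * (p i * Real.log (1 / p i)) - ε / 2 * p i ≤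
      q i * Real.log (1 / q i) := by
    intro i
    obtain ⟨hp0, hp1⟩ := hp i
    obtain ⟨hq0, -⟩ := hq i
    obtain ⟨ha, hb⟩ := happrox i
    have hr : 0 < q i / p i := div_pos hq0 hp0
    have hr2 : (q i / p i) ^ 2 ≤ 1 + ε := by
      have h5 : q i / p i ≤ Real.sqrt (1 + ε) := (div_le_iff₀ hp0).mpr hb
      calc (q i / p i) ^ 2 ≤ Real.sqrt (1 + ε) ^ 2 := by gcongr
        _ = 1 + ε := Real.sq_sqrt (by linarith)
    have h6 := mul_log_le_aux ε _ h0 hr hr2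
    rw [Real.log_div hq0.ne' hp0.ne', div_mul_eq_mul_div, div_le_iff₀ hp0] at h6
    have h7 : 0 ≤ -Real.log (p i) := by
      have := Real.log_nonpos hp0.le hp1.le
      linarith
    have h8 : (1 - Real.sqrt ε) * p i ≤ q i :=
      (mul_le_mul_of_nonneg_right hlow hp0.le).trans ha
    have h9 := mul_le_mul_of_nonneg_right h8 h7
    rw [one_div, one_div, Real.log_inv, Real.log_inv]
    linarith
  have hS := Finset.sum_le_sum (fun i (_ : i ∈ Finset.univ) => key i)
  rw [Finset.sum_sub_distrib, ← Finset.mul_sum, ← Finset.mul_sum, hsum, mul_one] at hS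
  exact hS
end

section
/- (Entropy guarantee of Theorem 3.) Let ε ∈ (0, 1/2), let p_1, …, p_k ∈ (0, 1) with Σ_{i=1}^k p_i = 1, and let p̃_1, …, p̃_k ∈ (0, 1] satisfy √(1−ε)·p_i ≤ p̃_i ≤ √(1+ε)·p_i for all i. Write H = Σ_{i=1}^k p_i ln(1/p_i) and H̃ = Σ_{i=1}^k p̃_i ln(1/p̃_i). Then | H̃ − H | ≤ √ε · H + √(3/2)·ε. -/
theorem term_bound (ε : ℝ) (h0 : 0 < ε) (h1 : ε < 1 / 2) (p q : ℝ) (hp : 0 < p) (hp1 : p < 1)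
    (hq : 0 < q) (ha : Real.sqrt (1 - ε) * p ≤ q) (hb : q ≤ Real.sqrt (1 + ε) * p) :
    |q * Real.log (1 / q) - p * Real.log (1 / p)| ≤
      Real.sqrt ε * (p * Real.log (1 / p)) + Real.sqrt (3 / 2) * ε * p := by
  obtain ⟨r, rfl⟩ : ∃ r, q = r * p := ⟨q / p, by field_simp⟩
  have ha' : Real.sqrt (1 - ε) ≤ r := le_of_mul_le_mul_right ha hp
  have hb' : r ≤ Real.sqrt (1 + ε) := le_of_mul_le_mul_right hb hp
  have hr : 0 < r := pos_of_mul_pos_left hq hp.le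
  have ha2 : 1 - ε ≤ r ^ 2 := (Real.sqrt_le_left hr.le).mp ha'
  have hb2 : r ^ 2 ≤ 1 + ε := (Real.le_sqrt' hr).mp hb'
  have hs : ε ≤ Real.sqrt ε := Real.le_sqrt_of_sq_le (by nlinarith)
  have ht : 1 ≤ Real.sqrt (3 / 2) := Real.le_sqrt_of_sq_le (by norm_num)
  have hlo : -ε ≤ r - 1 := by nlinarith
  have hhi : r - 1 ≤ ε := by nlinarith
  have hL : 0 < Real.log (1 / p) := Real.log_pos (by rw [lt_div_iff₀ hp]; linarith)
  have e : r * p * Real.log (1 / (r * p)) - p * Real.log (1 / p)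
      = (r - 1) * (p * Real.log (1 / p)) - r * Real.log r * p := by
    rw [one_div, one_div, Real.log_inv, Real.log_inv, Real.log_mul hr.ne' hp.ne']; ring
  have h2 : |r - 1| ≤ Real.sqrt ε := (abs_le.mpr ⟨hlo, hhi⟩).trans hs
  have h3 : |r * Real.log r| ≤ Real.sqrt (3 / 2) * ε := by
    have : |r * Real.log r| ≤ ε := by
      have u := Real.log_le_sub_one_of_pos hr
      have l := Real.one_sub_inv_le_log_of_pos hr
      have u' := mul_le_mul_of_nonneg_left u hr.le
      have l' := mul_le_mul_of_nonneg_left l hr.le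
      rw [mul_sub, mul_inv_cancel₀ hr.ne'] at l'
      rw [abs_le]
      constructor
      · linarith
      · rcases le_total 1 r with h | h <;> nlinarith
    nlinarith
  rw [e]
  refine (abs_sub _ _).trans ?_
  rw [abs_mul, abs_mul _ p, abs_of_pos hp, abs_of_pos (mul_pos hp hL)]
  gcongr

/-- Entropy guarantee of Theorem 3: if `√(1−ε)·p_i ≤ p̃_i ≤ √(1+ε)·p_i` for all `i`,
with `∑ p_i = 1` and `ε ∈ (0, 1/2)`, then the entropy estimate
`H̃ = ∑ p̃_i ln(1/p̃_i)` satisfies `|H̃ − H| ≤ √ε·H + √(3/2)·ε` where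
`H = ∑ p_i ln(1/p_i)`. -/
theorem random_projection_entropy_bound (ε : ℝ) (hε : ε ∈ Set.Ioo (0 : ℝ) (1 / 2))
    (k : ℕ) (p q : Fin k → ℝ)
    (hp : ∀ i, p i ∈ Set.Ioo (0 : ℝ) 1) (hsum : ∑ i, p i = 1)
    (hq : ∀ i, q i ∈ Set.Ioc (0 : ℝ) 1)
    (happrox : ∀ i, Real.sqrt (1 - ε) * p i ≤ q i ∧ q i ≤ Real.sqrt (1 + ε) * p i) :
    |(∑ i, q i * Real.log (1 / q i)) - ∑ i, p i * Real.log (1 / p i)| ≤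
      Real.sqrt ε * ∑ i, p i * Real.log (1 / p i) + Real.sqrt (3 / 2) * ε := by
  rw [← Finset.sum_sub_distrib]
  refine (Finset.abs_sum_le_sum_abs _ _).trans ?_
  refine (Finset.sum_le_sum fun i _ => term_bound ε hε.1 hε.2 (p i) (q i) (hp i).1 (hp i).2
    (hq i).1 (happrox i).1 (happrox i).2).trans ?_
  rw [Finset.sum_add_distrib, ← Finset.mul_sum, ← Finset.mul_sum, hsum, mul_one]
end

section
/- (Correctness of Clenshaw's recurrence for Chebyshev sums.) Let m ≥ 0, let α_0, …, α_m ∈ ℝ, and let x ∈ ℝ. Define b_{m+2} = b_{m+1} = 0 and, for k = m, m−1, …, 0, b_k = α_k + 2x·b_{k+1} − b_{k+2}. Then Σ_{k=0}^m α_k · T_k(x) = (1/2)·(α_0 + b_0 − b_2), where T_k is the degree-k Chebyshev polynomial of the first kind. -/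
open Polynomial

/-- Correctness of Clenshaw's recurrence for Chebyshev sums: if
`b_{m+2} = b_{m+1} = 0` and `b_k = α_k + 2x·b_{k+1} − b_{k+2}` for `k = m, …, 0`,
then `∑_{k=0}^m α_k T_k(x) = (1/2)(α_0 + b_0 − b_2)`, where `T_k` is the degree-`k`
Chebyshev polynomial of the first kind. -/
theorem clenshaw_chebyshev (m : ℕ) (α : ℕ → ℝ) (x : ℝ) (b : ℕ → ℝ)
    (hb2 : b (m + 2) = 0) (hb1 : b (m + 1) = 0)
    (hrec : ∀ k ≤ m, b k = α k + 2 * x * b (k + 1) - b (k + 2)) :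
    ∑ k ∈ Finset.range (m + 1), α k * (Polynomial.Chebyshev.T ℝ (k : ℤ)).eval x =
      (1 / 2) * (α 0 + b 0 - b 2) := by
  have key : ∀ n ≤ m, ∑ k ∈ Finset.range (n + 1),
      α k * (Polynomial.Chebyshev.T ℝ (k : ℤ)).eval x =
      b 0 - x * b 1 - b (n + 1) * (Polynomial.Chebyshev.T ℝ ((n : ℤ) + 1)).eval x
        + b (n + 2) * (Polynomial.Chebyshev.T ℝ (n : ℤ)).eval x := by
    intro n
    induction n with
    | zero =>
      intro h
      have h0 := hrec 0 h
      simp at h0 ⊢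
      linarith
    | succ n ih =>
      intro h
      have h1 := hrec (n + 1) h
      rw [Finset.sum_range_succ, ih (by omega)]
      have hT := congrArg (Polynomial.eval x) (Polynomial.Chebyshev.T_add_two ℝ (n : ℤ))
      simp only [Polynomial.eval_sub, Polynomial.eval_mul, Polynomial.eval_X,
        Polynomial.eval_ofNat] at hT
      have e : ((n + 1 : ℕ) : ℤ) = (n : ℤ) + 1 := by push_cast; rfl
      have e2 : (n : ℤ) + 1 + 1 = (n : ℤ) + 2 := by ring
      rw [e, e2, hT]
      have h2 : α (n + 1) = b (n + 1) - 2 * x * b (n + 1 + 1) + b (n + 1 + 2) := by linarith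
      rw [h2]
      ring
  have h0 := hrec 0 (Nat.zero_le m)
  rw [key m le_rfl, hb1, hb2]
  simp at h0 ⊢
  linarith
end

section
/- (Gaussian trace estimator.) Let A ∈ ℝ^{n×n} be symmetric positive semidefinite, let ε ∈ (0, 1) and δ ∈ (0, 1), and let s ≥ 20·ln(2/δ)/ε². If g_1, …, g_s are independent random vectors in ℝ^n, each with independent standard normal N(0,1) coordinates, then with probability at least 1 − δ, | tr(A) − (1/s)·Σ_{i=1}^s g_iᵀ A g_i | ≤ ε · tr(A). -/
open Matrix MeasureTheory ProbabilityTheory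

lemma gte_sq_mgf (t : ℝ) (ht : t < 1 / 2) :
    ∫⁻ x, ENNReal.ofReal (Real.exp (t * x ^ 2)) ∂(gaussianReal 0 1) =
      ENNReal.ofReal (√(1 - 2 * t))⁻¹ := by
  rw [gaussianReal_of_var_ne_zero _ one_ne_zero,
    lintegral_withDensity_eq_lintegral_mul _ (measurable_gaussianPDF 0 1) (by fun_prop)]
  have hb : 0 < 1 / 2 - t := by linarith
  have h1 : ∀ x : ℝ, (gaussianPDF 0 1 * fun x => ENNReal.ofReal (Real.exp (t * x ^ 2))) x
      = ENNReal.ofReal ((√(2 * Real.pi))⁻¹ * Real.exp (-(1 / 2 - t) * x ^ 2)) := by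
    intro x
    simp only [Pi.mul_apply, gaussianPDF, gaussianPDFReal]
    rw [← ENNReal.ofReal_mul (by positivity), mul_assoc, ← Real.exp_add]
    congr 2
    · simp
    · congr 1
      simp
      ring
  rw [lintegral_congr h1, ← ofReal_integral_eq_lintegral_ofReal
    ((integrable_exp_neg_mul_sq hb).const_mul _) (Filter.Eventually.of_forall fun x => by positivity),
    integral_const_mul, integral_gaussian]
  congr 1
  rw [← Real.sqrt_inv, ← Real.sqrt_inv, ← Real.sqrt_mul (by positivity)]
  congr 1
  have : 1 - 2 * t ≠ 0 := by linarith
  have := Real.pi_ne_zero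
  field_simp
  try ring

lemma gte_law {n : ℕ} (u : Fin n → ℝ) (hu : ∑ j, u j ^ 2 = 1) :
    (Measure.pi fun _ : Fin n => gaussianReal 0 1).map (fun g => u ⬝ᵥ g) = gaussianReal 0 1 := by
  have hm : Measurable (fun g : Fin n → ℝ => u ⬝ᵥ g) := by
    unfold dotProduct; fun_prop
  have : IsProbabilityMeasure
      ((Measure.pi fun _ : Fin n => gaussianReal 0 1).map (fun g => u ⬝ᵥ g)) :=
    Measure.isProbabilityMeasure_map hm.aemeasurable
  apply Measure.ext_of_charFun
  ext t
  rw [charFun_apply_real, integral_map hm.aemeasurable (by fun_prop), charFun_gaussianReal]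
  have h1 : ∀ g : Fin n → ℝ, Complex.exp (t * ((u ⬝ᵥ g : ℝ) : ℂ) * Complex.I)
      = ∏ j, Complex.exp (((t * u j : ℝ) : ℂ) * (g j : ℂ) * Complex.I) := by
    intro g
    rw [← Complex.exp_sum, dotProduct]
    congr 1
    push_cast
    rw [Finset.mul_sum, Finset.sum_mul]
    exact Finset.sum_congr rfl fun j _ => by ring
  simp_rw [h1]
  rw [integral_fintype_prod_eq_prod
    (f := fun j (x : ℝ) => Complex.exp (((t * u j : ℝ) : ℂ) * (x : ℂ) * Complex.I))]
  simp_rw [← charFun_apply_real, charFun_gaussianReal]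
  rw [← Complex.exp_sum]
  congr 1
  have hu' : ∑ j, (u j : ℂ) ^ 2 = 1 := by exact_mod_cast hu
  simp only [Complex.ofReal_zero, mul_zero, zero_mul, zero_sub, NNReal.coe_one,
    Complex.ofReal_one, one_mul, Complex.ofReal_mul, mul_pow]
  rw [Finset.sum_neg_distrib, ← Finset.sum_div, ← Finset.mul_sum, hu', mul_one]

lemma gte_dir {n : ℕ} (u : Fin n → ℝ) (hu : ∑ j, u j ^ 2 = 1) (t : ℝ) (ht : t < 1 / 2) :
    ∫⁻ g, ENNReal.ofReal (Real.exp (t * (u ⬝ᵥ g) ^ 2))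
      ∂(Measure.pi fun _ : Fin n => gaussianReal 0 1) = ENNReal.ofReal (√(1 - 2 * t))⁻¹ := by
  have hm : Measurable (fun g : Fin n → ℝ => u ⬝ᵥ g) := by
    unfold dotProduct; fun_prop
  have h := gte_sq_mgf t ht
  rw [← gte_law u hu, lintegral_map (by fun_prop) hm] at h
  exact h

lemma gte_one {n : ℕ} (A : Matrix (Fin n) (Fin n) ℝ) (hA : A.PosSemidef) (hT : 0 < A.trace)
    (t : ℝ) (ht : t < 1 / 2) :
    ∫⁻ g, ENNReal.ofReal (Real.exp (t * ((g ⬝ᵥ (A *ᵥ g)) / A.trace)))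
      ∂(Measure.pi fun _ : Fin n => gaussianReal 0 1) ≤ ENNReal.ofReal (√(1 - 2 * t))⁻¹ := by
  obtain ⟨m, v, hv⟩ := Matrix.posSemidef_iff_eq_sum_vecMulVec.mp hA
  set T := A.trace with hTdef
  set q : Fin m → ℝ := fun i => ∑ j, v i j ^ 2 with hq
  have hq0 : ∀ i, 0 ≤ q i := fun i => Finset.sum_nonneg fun j _ => sq_nonneg _
  have hTq : T = ∑ i, q i := by
    rw [hTdef, hv, Matrix.trace_sum]
    refine Finset.sum_congr rfl fun i _ => ?_
    simp [Matrix.trace, vecMulVec_apply, hq, sq]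
  have hQ : ∀ g : Fin n → ℝ, g ⬝ᵥ (A *ᵥ g) = ∑ i, (v i ⬝ᵥ g) ^ 2 := by
    intro g
    rw [hv, Matrix.sum_mulVec, dotProduct_sum]
    refine Finset.sum_congr rfl fun i _ => ?_
    rw [vecMulVec_mulVec]
    simp [sq, dotProduct_comm g (v i), dotProduct_smul]
  have hz : ∀ i, q i = 0 → ∀ g : Fin n → ℝ, v i ⬝ᵥ g = 0 := by
    intro i hi g
    have h2 := (Finset.sum_eq_zero_iff_of_nonneg (fun j _ => sq_nonneg (v i j))).1 hi
    refine Finset.sum_eq_zero fun j hj => ?_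
    have := h2 j hj
    rw [pow_eq_zero_iff two_ne_zero] at this
    rw [this, zero_mul]
  set u : Fin m → Fin n → ℝ := fun i j => v i j / √(q i) with hu
  have hud : ∀ i g, q i * (u i ⬝ᵥ g) ^ 2 = (v i ⬝ᵥ g) ^ 2 := by
    intro i g
    have : u i ⬝ᵥ g = (v i ⬝ᵥ g) / √(q i) := by
      simp only [hu, dotProduct]
      rw [Finset.sum_div]
      exact Finset.sum_congr rfl fun j _ => by ring
    rw [this, div_pow, Real.sq_sqrt (hq0 i)]
    by_cases h : q i = 0
    · rw [hz i h g, h]; simp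
    · field_simp
  have hu1 : ∀ i, q i ≠ 0 → ∑ j, u i j ^ 2 = 1 := by
    intro i hi
    simp only [hu, div_pow, Real.sq_sqrt (hq0 i)]
    rw [← Finset.sum_div]
    exact div_self hi
  have hw : ∑ i, q i / T = 1 := by
    rw [← Finset.sum_div, ← hTq, div_self hT.ne']
  have hm : ∀ i, Measurable (fun g : Fin n → ℝ => u i ⬝ᵥ g) := by
    intro i; unfold dotProduct; fun_prop
  have hJ : ∀ g : Fin n → ℝ, ENNReal.ofReal (Real.exp (t * ((g ⬝ᵥ (A *ᵥ g)) / T))) ≤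
      ∑ i, ENNReal.ofReal (q i / T) * ENNReal.ofReal (Real.exp (t * (u i ⬝ᵥ g) ^ 2)) := by
    intro g
    have h1 := convexOn_exp.map_sum_le (t := Finset.univ) (w := fun i => q i / T)
      (p := fun i => t * (u i ⬝ᵥ g) ^ 2) (fun i _ => div_nonneg (hq0 i) hT.le) hw
      (fun i _ => Set.mem_univ _)
    have h2 : ∑ i, (q i / T) • (t * (u i ⬝ᵥ g) ^ 2) = t * ((g ⬝ᵥ (A *ᵥ g)) / T) := by
      rw [hQ, Finset.sum_div, Finset.mul_sum]
      refine Finset.sum_congr rfl fun i _ => ?_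
      rw [← hud, smul_eq_mul]; ring
    rw [h2] at h1
    refine (ENNReal.ofReal_le_ofReal h1).trans (le_of_eq ?_)
    rw [ENNReal.ofReal_sum_of_nonneg fun i _ =>
      smul_nonneg (div_nonneg (hq0 i) hT.le) (Real.exp_pos _).le]
    exact Finset.sum_congr rfl fun i _ => ENNReal.ofReal_mul (div_nonneg (hq0 i) hT.le)
  refine (lintegral_mono hJ).trans ?_
  rw [lintegral_finsetSum _ (fun i _ => by have := hm i; fun_prop)]
  calc _ ≤ ∑ i, ENNReal.ofReal (q i / T) * ENNReal.ofReal (√(1 - 2 * t))⁻¹ := by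
        refine Finset.sum_le_sum fun i _ => ?_
        rw [lintegral_const_mul _ (by have := hm i; fun_prop)]
        by_cases h : q i = 0
        · simp [h]
        · rw [gte_dir (u i) (hu1 i h) t ht]
    _ = _ := by
        rw [← Finset.sum_mul, ← ENNReal.ofReal_sum_of_nonneg
          (fun i _ => div_nonneg (hq0 i) hT.le), hw]
        simp

/-- Chernoff bound. -/
lemma gte_tail {n s : ℕ} (A : Matrix (Fin n) (Fin n) ℝ) (hA : A.PosSemidef) (hT : 0 < A.trace)
    (t c : ℝ) (ht : t < 1 / 2) :
    (Measure.pi fun _ : Fin s => Measure.pi fun _ : Fin n => gaussianReal 0 1)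
      {g | s * c ≤ t * ∑ i, (g i ⬝ᵥ (A *ᵥ g i)) / A.trace} ≤
      ENNReal.ofReal (Real.exp (s * (-Real.log (1 - 2 * t) / 2 - c))) := by
  set μ := Measure.pi fun _ : Fin s => Measure.pi fun _ : Fin n => gaussianReal 0 1
  have hm : Measurable (fun g : Fin n → ℝ => g ⬝ᵥ (A *ᵥ g)) := by
    unfold dotProduct mulVec dotProduct; fun_prop
  have hmf : Measurable (fun g : Fin n → ℝ =>
      ENNReal.ofReal (Real.exp (t * ((g ⬝ᵥ (A *ᵥ g)) / A.trace)))) := by fun_prop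
  have hp := lintegral_prod_eq_prod_lintegral_of_indepFun (μ := μ) Finset.univ
    (fun i g => ENNReal.ofReal (Real.exp (t * ((g i ⬝ᵥ (A *ᵥ g i)) / A.trace))))
    (iIndepFun_pi (X := fun _ (g : Fin n → ℝ) =>
      ENNReal.ofReal (Real.exp (t * ((g ⬝ᵥ (A *ᵥ g)) / A.trace)))) fun i => hmf.aemeasurable)
    (fun i => hmf.comp (measurable_pi_apply i))
  have hi : ∀ i, ∫⁻ g, ENNReal.ofReal (Real.exp (t * ((g i ⬝ᵥ (A *ᵥ g i)) / A.trace))) ∂μ ≤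
      ENNReal.ofReal (√(1 - 2 * t))⁻¹ := by
    intro i
    refine le_trans (le_of_eq ?_) (gte_one A hA hT t ht)
    exact (measurePreserving_eval (fun _ : Fin s => Measure.pi fun _ : Fin n => gaussianReal 0 1)
      i).lintegral_comp hmf
  have hM := meas_ge_le_lintegral_div (μ := μ)
    (f := fun g => ∏ i, ENNReal.ofReal (Real.exp (t * ((g i ⬝ᵥ (A *ᵥ g i)) / A.trace))))
    (Finset.measurable_prod _ fun i _ => hmf.comp (measurable_pi_apply i)).aemeasurable
    (ε := ENNReal.ofReal (Real.exp (s * c))) (by simp [Real.exp_pos]) ENNReal.ofReal_ne_top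
  have hset : {g : Fin s → Fin n → ℝ | s * c ≤ t * ∑ i, (g i ⬝ᵥ (A *ᵥ g i)) / A.trace} ⊆
      {g | ENNReal.ofReal (Real.exp (s * c)) ≤
        ∏ i, ENNReal.ofReal (Real.exp (t * ((g i ⬝ᵥ (A *ᵥ g i)) / A.trace)))} := by
    intro g hg
    simp only [Set.mem_ofPred_eq] at hg ⊢
    rw [← ENNReal.ofReal_prod_of_nonneg fun i _ => (Real.exp_pos _).le, ← Real.exp_sum,
      ← Finset.mul_sum]
    exact ENNReal.ofReal_le_ofReal (Real.exp_le_exp.2 hg)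
  refine (measure_mono hset).trans (hM.trans ?_)
  rw [hp]
  have h0 : 0 < 1 - 2 * t := by linarith
  have hsq : (√(1 - 2 * t))⁻¹ = Real.exp (-Real.log (1 - 2 * t) / 2) := by
    rw [neg_div, Real.exp_neg, ← Real.log_sqrt h0.le, Real.exp_log (Real.sqrt_pos.2 h0)]
  calc _ ≤ (ENNReal.ofReal (√(1 - 2 * t))⁻¹) ^ s / ENNReal.ofReal (Real.exp (s * c)) := by
        gcongr
        refine (Finset.prod_le_prod' fun i _ => hi i).trans (le_of_eq ?_)
        simp
    _ = _ := by
        rw [← ENNReal.ofReal_pow (by positivity), ← ENNReal.ofReal_div_of_pos (Real.exp_pos _),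
          hsq, ← Real.exp_nat_mul, ← Real.exp_sub]
        congr 2
        ring

theorem gaussian_trace_estimator {n : ℕ} (A : Matrix (Fin n) (Fin n) ℝ)
    (hA : A.PosSemidef) (ε δ : ℝ) (hε : ε ∈ Set.Ioo (0 : ℝ) 1)
    (hδ : δ ∈ Set.Ioo (0 : ℝ) 1) (s : ℕ)
    (hs : 20 * Real.log (2 / δ) / ε ^ 2 ≤ s) :
    ENNReal.ofReal (1 - δ) ≤
      (Measure.pi fun _ : Fin s => Measure.pi fun _ : Fin n => gaussianReal 0 1)
        {g | |A.trace - (1 / s) * ∑ i, g i ⬝ᵥ (A *ᵥ g i)| ≤ ε * A.trace} := by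
  obtain ⟨hε0, hε1⟩ := hε
  obtain ⟨hδ0, hδ1⟩ := hδ
  rcases hA.trace_nonneg.eq_or_lt with hT | hT
  · have hA0 : A = 0 := hA.trace_eq_zero_iff.1 hT.symm
    subst hA0
    simp [hδ0.le]
  set μ := Measure.pi fun _ : Fin s => Measure.pi fun _ : Fin n => gaussianReal 0 1 with hμ
  have hlog : 0 < Real.log (2 / δ) := Real.log_pos (by rw [lt_div_iff₀ hδ0]; linarith)
  have hs0 : (0 : ℝ) < s := lt_of_lt_of_le (by positivity) hs
  rw [div_le_iff₀ (by positivity)] at hs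
  have hlogδ : Real.exp (-Real.log (2 / δ)) = δ / 2 := by
    rw [Real.exp_neg, Real.exp_log (by positivity), inv_div]
  have hU := gte_tail (s := s) A hA hT (ε / (2 * (1 + ε))) (ε / 2)
    (by rw [div_lt_div_iff₀ (by positivity) (by norm_num)]; linarith)
  have hL := gte_tail (s := s) A hA hT (-(ε / 2)) (-(ε / 2) * (1 - ε)) (by linarith)
  have hU' : Real.exp (s * (-Real.log (1 - 2 * (ε / (2 * (1 + ε)))) / 2 - ε / 2)) ≤ δ / 2 := by
    rw [← hlogδ, Real.exp_le_exp]
    have h1 : 1 - 2 * (ε / (2 * (1 + ε))) = (1 + ε)⁻¹ := by field_simp; ring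
    rw [h1, Real.log_inv]
    have h2 : Real.log (1 + ε) ≤ ε - ε ^ 2 / 10 := by
      rw [Real.log_le_iff_le_exp (by positivity)]
      have h3 := Real.quadratic_le_exp_of_nonneg (x := ε - ε ^ 2 / 10) (by nlinarith)
      nlinarith [mul_pos hε0 hε0, mul_pos (mul_pos hε0 hε0) (sub_pos.2 hε1), sq_nonneg (ε ^ 2)]
    nlinarith
  have hL' : Real.exp (s * (-Real.log (1 - 2 * (-(ε / 2))) / 2 - -(ε / 2) * (1 - ε))) ≤ δ / 2 := by
    rw [← hlogδ, Real.exp_le_exp]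
    have h1 : 1 - 2 * (-(ε / 2)) = 1 + ε := by ring
    rw [h1]
    have h2 : ε - ε ^ 2 / 2 ≤ Real.log (1 + ε) := by
      refine le_trans ?_ (Real.le_log_one_add_of_nonneg hε0.le)
      rw [le_div_iff₀ (by positivity)]
      nlinarith [pow_pos hε0 3]
    nlinarith
  set S := {g : Fin s → Fin n → ℝ |
    |A.trace - (1 / s) * ∑ i, g i ⬝ᵥ (A *ᵥ g i)| ≤ ε * A.trace} with hS
  have hm : Measurable (fun g : Fin n → ℝ => g ⬝ᵥ (A *ᵥ g)) := by
    unfold dotProduct mulVec dotProduct; fun_prop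
  have hmS : MeasurableSet S := by
    refine measurableSet_le ?_ measurable_const
    have : Measurable fun g : Fin s → Fin n → ℝ => ∑ i, g i ⬝ᵥ (A *ᵥ g i) :=
      Finset.measurable_sum _ fun i _ => hm.comp (measurable_pi_apply i)
    exact continuous_abs.measurable.comp (measurable_const.sub (this.const_mul _))
  have hc : μ Sᶜ ≤ ENNReal.ofReal δ := by
    refine (measure_mono (?_ : Sᶜ ⊆ _ ∪ _)).trans ((measure_union_le _ _).trans
      ((add_le_add (hU.trans (ENNReal.ofReal_le_ofReal hU'))
        (hL.trans (ENNReal.ofReal_le_ofReal hL'))).trans (le_of_eq ?_)))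
    · intro g hg
      simp only [hS, Set.mem_compl_iff, Set.mem_ofPred_eq, not_le, Set.mem_union] at hg ⊢
      rw [← Finset.sum_div]
      set Q := ∑ i, g i ⬝ᵥ (A *ᵥ g i)
      have hQ : Q / A.trace = s * ((1 / s * Q) / A.trace) := by field_simp
      rw [hQ]
      generalize 1 / (s : ℝ) * Q = R at *
      rw [lt_abs] at hg
      rcases hg with h | h
      · right
        have : R / A.trace ≤ 1 - ε := by rw [div_le_iff₀ hT]; linarith
        nlinarith [mul_pos hε0 hs0]
      · left
        have : 1 + ε ≤ R / A.trace := by rw [le_div_iff₀ hT]; linarith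
        calc s * (ε / 2) = ε / (2 * (1 + ε)) * (s * (1 + ε)) := by field_simp
          _ ≤ _ := by gcongr
    · rw [← ENNReal.ofReal_add (by positivity) (by positivity)]; congr 1; ring
  have h1 := prob_add_prob_compl (μ := μ) hmS
  rw [ENNReal.ofReal_sub _ hδ0.le, ENNReal.ofReal_one, ← h1]
  exact tsub_le_iff_right.2 (by gcongr)
end
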